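/- arXiv:1603.01697 — 3 statements merged into one kernel-verified Lean document; each statement's English description precedes it below -/
import Mathlib

section
/- For all integers n ≥ m ≥ 3, the 2-color Ramsey numbers of 3-uniform loose paths and cycles satisfy R(P^3_n, P^3_m) = R(P^3_n, C^3_m) = R(C^3_n, C^3_m) + 1 = 2n + ⌊(m+1)/2⌋. -/
/-- A copy of the `k`-uniform loose path with `n` edges, all of color `b`
(`true` = red, `false` = blue), in the coloring `col` of the `k`-subsets of `V`.
The path is given by an injective listing `f 0, f 1, …, f (n*(k-1))` of its
vertices, with `i`-th edge `{f (i*(k-1)), …, f (i*(k-1)+k-1)}`. -/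
def HasLoosePath {V : Type*} [DecidableEq V] (k n : ℕ) (col : Finset V → Bool)
    (b : Bool) : Prop :=
  ∃ f : ℕ → V, Set.InjOn f (Set.Iio (n * (k - 1) + 1)) ∧
    ∀ i < n, col ((Finset.range k).image fun j => f (i * (k - 1) + j)) = b

/-- A copy of the `k`-uniform loose cycle with `n` edges, all of color `b`
(`true` = red, `false` = blue), in the coloring `col` of the `k`-subsets of `V`.
The cycle is given by an injective listing `f 0, …, f (n*(k-1) - 1)` of its
vertices, with `i`-th edge `{f (i*(k-1) % (n*(k-1))), …, f ((i*(k-1)+k-1) % (n*(k-1)))}`. -/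
def HasLooseCycle {V : Type*} [DecidableEq V] (k n : ℕ) (col : Finset V → Bool)
    (b : Bool) : Prop :=
  ∃ f : ℕ → V, Set.InjOn f (Set.Iio (n * (k - 1))) ∧
    ∀ i < n, col ((Finset.range k).image fun j => f ((i * (k - 1) + j) % (n * (k - 1)))) = b

/-- `R(P^k_n, P^k_m)`: the least positive `N` such that every red-blue coloring of the
`k`-subsets of an `N`-set contains a red `P^k_n` or a blue `P^k_m`. -/
noncomputable def RamseyPP (k n m : ℕ) : ℕ :=
  sInf {N | 0 < N ∧ ∀ col : Finset (Fin N) → Bool,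
    HasLoosePath k n col true ∨ HasLoosePath k m col false}

/-- `R(P^k_n, C^k_m)`. -/
noncomputable def RamseyPC (k n m : ℕ) : ℕ :=
  sInf {N | 0 < N ∧ ∀ col : Finset (Fin N) → Bool,
    HasLoosePath k n col true ∨ HasLooseCycle k m col false}

/-- `R(C^k_n, P^k_m)`. -/
noncomputable def RamseyCP (k n m : ℕ) : ℕ :=
  sInf {N | 0 < N ∧ ∀ col : Finset (Fin N) → Bool,
    HasLooseCycle k n col true ∨ HasLoosePath k m col false}

/-- `R(C^k_n, C^k_m)`. -/
noncomputable def RamseyCC (k n m : ℕ) : ℕ :=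
  sInf {N | 0 < N ∧ ∀ col : Finset (Fin N) → Bool,
    HasLooseCycle k n col true ∨ HasLooseCycle k m col false}

namespace LR

def LP {V : Type*} (R : V → V → V → Prop) : V → List (V × V) → V → Prop
  | x, [], z => x = z
  | x, s :: l, z => R x s.1 s.2 ∧ LP R s.2 l z

def vs {V : Type*} : List (V × V) → List V
  | [] => []
  | s :: l => s.1 :: s.2 :: vs l

def Cyc {V : Type*} (R : V → V → V → Prop) (n : ℕ) : Prop :=
  ∃ x l, LP R x l x ∧ (vs l).Nodup ∧ l.length = n

def Pth {V : Type*} (R : V → V → V → Prop) (n : ℕ) : Prop :=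
  ∃ x z l, LP R x l z ∧ (x :: vs l).Nodup ∧ l.length = n

def SymR {V : Type*} (R : V → V → V → Prop) : Prop :=
  (∀ a b c, R a b c → R b a c) ∧ (∀ a b c, R a b c → R a c b)

def Bl {V : Type*} (R : V → V → V → Prop) : V → V → V → Prop := fun a b c => ¬ R a b c

theorem SymR.bl {V : Type*} {R : V → V → V → Prop} (h : SymR R) : SymR (Bl R) :=
  ⟨fun _ _ _ hn hr => hn (h.1 _ _ _ hr), fun _ _ _ hn hr => hn (h.2 _ _ _ hr)⟩

theorem SymR.rl {V : Type*} {R : V → V → V → Prop} (h : SymR R) {a b c : V} (hr : R a b c) :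
    R b c a := h.2 _ _ _ (h.1 _ _ _ hr)
theorem SymR.rr {V : Type*} {R : V → V → V → Prop} (h : SymR R) {a b c : V} (hr : R a b c) :
    R c a b := h.1 _ _ _ (h.2 _ _ _ hr)
theorem SymR.s13 {V : Type*} {R : V → V → V → Prop} (h : SymR R) {a b c : V} (hr : R a b c) :
    R c b a := h.1 _ _ _ (h.rl hr)

theorem bl_bl {V : Type*} (R : V → V → V → Prop) : Bl (Bl R) = R := by
  funext a b c; simp [Bl]

@[simp] theorem vs_nil {V : Type*} : vs ([] : List (V × V)) = [] := rfl
@[simp] theorem vs_cons {V : Type*} (s : V × V) (l) : vs (s :: l) = s.1 :: s.2 :: vs l := rfl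
@[simp] theorem vs_append {V : Type*} (l l' : List (V × V)) : vs (l ++ l') = vs l ++ vs l' := by
  induction l with
  | nil => rfl
  | cons s l ih => simp [ih]
theorem vs_length {V : Type*} (l : List (V × V)) : (vs l).length = 2 * l.length := by
  induction l with
  | nil => rfl
  | cons s l ih => simp [ih]; ring
@[simp] theorem LP_nil {V : Type*} (R : V → V → V → Prop) (x z : V) : LP R x [] z ↔ x = z := Iff.rfl
@[simp] theorem LP_cons {V : Type*} (R : V → V → V → Prop) (x z : V) (s l) :
    LP R x (s :: l) z ↔ R x s.1 s.2 ∧ LP R s.2 l z := Iff.rfl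
theorem LP_append {V : Type*} (R : V → V → V → Prop) (l l' : List (V × V)) (x z : V) :
    LP R x (l ++ l') z ↔ ∃ y, LP R x l y ∧ LP R y l' z := by
  induction l generalizing x with
  | nil => simp
  | cons s l ih => simp [ih]; tauto

theorem LP_end {V : Type*} {R : V → V → V → Prop} {l : List (V × V)} {x z : V}
    (h : LP R x l z) : z = x ∨ z ∈ vs l := by
  induction l generalizing x with
  | nil => left; exact h.symm
  | cons s l ih =>
    rcases ih h.2 with h | h
    · right; simp [h]
    · right; simp [h]

theorem LP_rev {V : Type*} {R : V → V → V → Prop} (hs : SymR R) {l : List (V × V)} {x z : V}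
    (h : LP R x l z) : ∃ l', LP R z l' x ∧ l'.length = l.length ∧ (x :: vs l).Perm (z :: vs l') := by
  induction l generalizing x with
  | nil => exact ⟨[], h.symm, rfl, by simp at h; simp [h]⟩
  | cons s l ih =>
    obtain ⟨l', h1, h2, h3⟩ := ih h.2
    refine ⟨l' ++ [(s.1, x)], ?_, by simp [h2], ?_⟩
    · rw [LP_append]
      exact ⟨s.2, h1, hs.1 _ _ _ (hs.2 _ _ _ (hs.1 _ _ _ h.1)), rfl⟩
    · have : (z :: vs (l' ++ [(s.1, x)])) = (z :: vs l') ++ [s.1, x] := by simp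
      rw [this]
      have e1 : ((z :: vs l') ++ [s.1, x]).Perm ((s.2 :: vs l) ++ [s.1, x]) := h3.symm.append_right _
      refine List.Perm.trans ?_ e1.symm
      refine List.Perm.trans ?_ List.perm_append_comm
      simp
      exact List.Perm.swap _ _ _

def Link {V : Type*} (B : V → V → V → Prop) (W : Finset V) (S : Finset V) (c d : V) : Prop :=
  ∀ w ∈ W, ∀ w' ∈ W, w ≠ w' → w ≠ c → w' ≠ d → ∃ s1 ∈ S, ∃ s2 ∈ S, ∃ s3 ∈ S,
    s1 ≠ s2 ∧ s1 ≠ s3 ∧ s2 ≠ s3 ∧ B w s1 s2 ∧ B s2 s3 w'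

def Ch {V : Type*} (B : V → V → V → Prop) (W : Finset V) (r : ℕ) (S : Finset V) (c : V) : Prop :=
  ∀ T ⊆ W, r + 1 ≤ T.card → ∃ T' ⊆ T, T'.card = r ∧ ∀ w0 ∈ W, w0 ∉ T' → w0 ≠ c →
    ∃ l e, LP B w0 l e ∧ (vs l).Nodup ∧ (∀ v ∈ vs l, v ∈ T' ∨ v ∈ S) ∧ l.length = 2 * r ∧
      ((r = 0 ∧ e = w0) ∨ e ∈ T')

theorem Ch.zero {V : Type*} (B : V → V → V → Prop) (W S : Finset V) (c : V) : Ch B W 0 S c := by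
  intro T hT h
  refine ⟨∅, by simp, rfl, ?_⟩
  intro w0 _ _ _
  exact ⟨[], w0, rfl, by simp, by simp, rfl, Or.inl ⟨rfl, rfl⟩⟩

theorem Ch.mono {V : Type*} {B : V → V → V → Prop} {W S S' : Finset V} {r : ℕ} {c : V}
    (h : Ch B W r S c) (hS : S ⊆ S') : Ch B W r S' c := by
  intro T hT hc
  obtain ⟨T', h1, h2, h3⟩ := h T hT hc
  refine ⟨T', h1, h2, ?_⟩
  intro w0 a1 a2 a3
  obtain ⟨l, e, b1, b2, b3, b4⟩ := h3 w0 a1 a2 a3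
  exact ⟨l, e, b1, b2, fun v hv => (b3 v hv).imp id (fun h => hS h), b4⟩

theorem Ch.cons {V : Type*} [DecidableEq V] {B : V → V → V → Prop} {W S S1 : Finset V} {r : ℕ}
    {c d c' : V} (hl : Link B W S1 c d) (h : Ch B W r S c') (hd : Disjoint S1 S)
    (hW : Disjoint (S1 ∪ S) W) : Ch B W (r + 1) (S1 ∪ S) c := by
  intro T hT hc
  obtain ⟨w1, hw1, hw1d, hw1c⟩ : ∃ w1 ∈ T, w1 ≠ d ∧ (r = 0 ∨ w1 ≠ c') := by
    by_contra hcon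
    push Not at hcon
    by_cases hr : r = 0
    · have : T ⊆ {d} := by
        intro t ht
        by_contra hne
        exact (hcon t ht (by simpa using hne)).1 hr
      have := Finset.card_le_card this
      simp at this; omega
    · have : T ⊆ {d, c'} := by
        intro t ht
        by_cases hne : t = d
        · simp [hne]
        · simp [(hcon t ht hne).2]
      have := Finset.card_le_card this
      have := Finset.card_le_two (a := d) (b := c')
      omega
  obtain ⟨c'', hc'', h⟩ : ∃ c'', w1 ≠ c'' ∧ Ch B W r S c'' := by
    rcases hw1c with h0 | h0
    · subst h0; exact ⟨d, hw1d, Ch.zero _ _ _ _⟩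
    · exact ⟨c', h0, h⟩
  have hTe : (T.erase w1).card + 1 = T.card := Finset.card_erase_add_one hw1
  obtain ⟨T', hT', hcT, h3⟩ := h (T.erase w1) ((Finset.erase_subset _ _).trans hT) (by omega)
  have hw1T : w1 ∉ T' := fun hh => by simpa using hT' hh
  refine ⟨insert w1 T', ?_, ?_, ?_⟩
  · intro t ht
    rcases Finset.mem_insert.1 ht with rfl | ht
    · exact hw1
    · exact Finset.mem_of_mem_erase (hT' ht)
  · rw [Finset.card_insert_of_notMem hw1T, hcT]
  · intro w0 hw0 hw0T hw0c
    simp only [Finset.mem_insert, not_or] at hw0T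
    obtain ⟨l, e, b1, b2, b3, b4, b5⟩ := h3 w1 (hT hw1) hw1T hc''
    obtain ⟨s1, hs1, s2, hs2, s3, hs3, n1, n2, n3, B1, B2⟩ := hl w0 hw0 w1 (hT hw1) hw0T.1 hw0c hw1d
    have hT'W : ∀ t ∈ T', t ∈ W := fun t ht => hT (Finset.mem_of_mem_erase (hT' ht))
    have hSW : ∀ t ∈ S1, t ∉ W := fun t ht hw =>
      Finset.disjoint_left.1 hW (Finset.mem_union_left _ ht) hw
    have hSW' : ∀ t ∈ S, t ∉ W := fun t ht hw =>
      Finset.disjoint_left.1 hW (Finset.mem_union_right _ ht) hw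
    have hSS : ∀ t ∈ S1, t ∉ S := fun t ht hw => Finset.disjoint_left.1 hd ht hw
    have key : ∀ t ∈ S1, t ∉ vs l := by
      intro t ht hv
      rcases b3 t hv with h | h
      · exact hSW t ht (hT'W t h)
      · exact hSS t ht h
    have key2 : w1 ∉ vs l := by
      intro hv
      rcases b3 _ hv with h | h
      · exact hw1T h
      · exact hSW' _ h (hT hw1)
    have key3 : ∀ t ∈ S1, t ≠ w1 := fun t ht he => hSW t ht (he ▸ hT hw1)
    refine ⟨(s1, s2) :: (s3, w1) :: l, e, ⟨B1, B2, b1⟩, ?_, ?_, ?_, ?_⟩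
    · simp only [vs_cons, List.nodup_cons, List.mem_cons, not_or]
      exact ⟨⟨n1, n2, key3 _ hs1, key _ hs1⟩, ⟨n3, key3 _ hs2, key _ hs2⟩, ⟨key3 _ hs3, key _ hs3⟩, key2, b2⟩
    · intro v hv
      simp only [vs_cons, List.mem_cons] at hv
      rcases hv with rfl | rfl | rfl | rfl | hv
      · right; exact Finset.mem_union_left _ hs1
      · right; exact Finset.mem_union_left _ hs2
      · right; exact Finset.mem_union_left _ hs3
      · left; simp
      · rcases b3 v hv with h | h
        · left; simp [h]
        · right; exact Finset.mem_union_right _ h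
    · simp [b4]; ring
    · right
      rcases b5 with h | h
      · simp [h.2]
      · simp [h]

theorem block {V : Type*} [DecidableEq V] {R : V → V → V → Prop} (hs : SymR R) {W : Finset V}
    {u p y q z : V} (hnd : [u, p, y, q, z].Nodup) (hpW : p ∉ W) (hyW : y ∉ W) (hqW : q ∉ W)
    (hred : R y q z)
    (H : ∀ i1 i2 i3 i4 i5, [i1, i2, i3, i4, i5].Nodup →
      (∀ v ∈ [i1, i2, i3, i4, i5], v = p ∨ v = y ∨ v = q ∨ v ∈ W) →
      R u i1 i2 → R i2 i3 i4 → R i4 i5 z → False) :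
    ∃ c d, Link (Bl R) W {u, p, y, q} c d ∨ Link (Bl R) W {u, p, z} c d := by
  have s1 := hs.1
  have s2 := hs.2
  simp only [List.nodup_cons, List.mem_cons, not_or, List.not_mem_nil, not_false_eq_true,
    List.nodup_nil, and_true] at hnd
  obtain ⟨⟨up, uy, uq, uz⟩, ⟨py, pq, pz⟩, ⟨yq, yz⟩, qz⟩ := hnd
  by_cases hA : ∃ a ∈ W, R u p a
  · obtain ⟨a, ha, hA⟩ := hA
    refine ⟨a, a, Or.inl ?_⟩
    intro w hw w' hw' hne hwa hwa'
    refine ⟨y, by simp, p, by simp, q, by simp, Ne.symm py, yq, pq, ?_, ?_⟩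
    · intro hr
      refine H a p w y q ?_ ?_ (s2 _ _ _ hA) (hs.rr hr) hred
      · simp; grind
      · simp; grind
    · intro hr
      refine H a p w' q y ?_ ?_ (s2 _ _ _ hA) (s2 _ _ _ hr) (s1 _ _ _ hred)
      · simp; grind
      · simp; grind
  · push Not at hA
    by_cases hQ : ∃ d, ∀ w ∈ W, w ≠ d → ¬ R p z w
    · obtain ⟨d, hd⟩ := hQ
      refine ⟨u, d, Or.inr ?_⟩
      intro w hw w' hw' hne hwa hwa'
      refine ⟨u, by simp, p, by simp, z, by simp, up, uz, pz, ?_, hd w' hw' hwa'⟩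
      intro hr
      exact hA w hw (hs.rl hr)
    · push Not at hQ
      refine ⟨u, u, Or.inl ?_⟩
      intro w hw w' hw' hne hwa hwa'
      by_cases hB : R p y w'
      · refine ⟨p, by simp, u, by simp, q, by simp, Ne.symm up, pq, uq, ?_, ?_⟩
        · intro hr
          exact hA w hw (hs.s13 hr)
        · intro hr
          obtain ⟨t, ht, htw, hr2⟩ := hQ w'
          refine H q w' y p t ?_ ?_ hr (s1 _ _ _ (s2 _ _ _ (s1 _ _ _ hB))) (s2 _ _ _ hr2)
          · simp; grind
          · simp; grind
      · refine ⟨u, by simp, p, by simp, y, by simp, up, uy, py, ?_, hB⟩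
        intro hr
        exact hA w hw (hs.rl hr)

set_option maxHeartbeats 1000000 in
theorem blocks {V : Type*} [DecidableEq V] {R : V → V → V → Prop} (hs : SymR R) {n : ℕ}
    (hno : ¬ Cyc R n) {W : Finset V} {p0 y1 y0 : V} (hmid : R y0 p0 y1) :
    ∀ (k : ℕ) (x : V) (rem bx bu : List (V × V)) (u : V), rem.length = 2 * k →
    LP R x rem y0 → LP R y1 bx x → LP R y1 bu u →
    (p0 :: y1 :: (vs rem ++ vs bx)).Nodup → (vs bu).Perm (vs bx) → bu.length = bx.length →
    2 * k + bx.length + 2 = n → (∀ v ∈ p0 :: y1 :: (vs rem ++ vs bx), v ∉ W) →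
    ∃ S c u' bu', Ch (Bl R) W k S c ∧ S ⊆ insert u (vs rem).toFinset ∧ u' ∉ S ∧
      (u' = u ∨ u' ∈ vs rem) ∧ LP R y1 bu' u' ∧ (vs bu').Perm (vs rem ++ vs bx) ∧
      bu'.length = bx.length + 2 * k := by
  intro k
  induction k with
  | zero =>
    intro x rem bx bu u hlen hrem hbx hbu hnd hperm hl hn hW
    have : rem = [] := List.length_eq_zero_iff.1 (by simpa using hlen)
    subst this
    exact ⟨∅, u, u, bu, Ch.zero _ _ _ _, by simp, by simp, Or.inl rfl, hbu, by simpa using hperm, by simp [hl]⟩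
  | succ k ih =>
    intro x rem bx bu u hlen hrem hbx hbu hnd hperm hl hn hW
    match rem, hlen, hrem, hnd, hW with
    | [], hlen, _, _, _ => simp at hlen
    | [_], hlen, _, _, _ => simp at hlen; omega
    | (p, y) :: (q, z) :: rem', hlen, hrem, hnd, hW =>
    simp only [LP_cons] at hrem
    obtain ⟨he, he', hrem'⟩ := hrem
    simp only [List.length_cons] at hlen
    simp only [vs_cons, List.cons_append] at hnd hW ⊢
    have hu : u = y1 ∨ u ∈ vs bx := (LP_end hbu).imp id (fun h => hperm.subset h)
    have huW : u ∉ W := by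
      apply hW; simp; tauto
    have hbund : (p0 :: y1 :: p :: y :: q :: z :: (vs rem' ++ vs bu)).Nodup := by
      refine List.Perm.nodup ?_ hnd
      simp only [List.perm_cons]
      exact hperm.symm.append_left _
    have hbuW : ∀ v ∈ vs bu, v ∉ W := fun v hv => hW v (by
      have := hperm.subset hv
      simp [this])
    have hnd5 : [u, p, y, q, z].Nodup := by
      simp only [List.nodup_cons, List.mem_cons, not_or, List.mem_append] at hnd ⊢
      rcases hu with rfl | hu
      · simp; grind
      · simp; grind
    have H : ∃ c d, Link (Bl R) W {u, p, y, q} c d ∨ Link (Bl R) W {u, p, z} c d := by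
      refine block hs hnd5 (hW _ (by simp)) (hW _ (by simp)) (hW _ (by simp)) he' ?_
      intro i1 i2 i3 i4 i5 hi hin r1 r2 r3
      apply hno
      refine ⟨u, [(i1, i2), (i3, i4), (i5, z)] ++ (rem' ++ ((p0, y1) :: bu)), ?_, ?_, ?_⟩
      · rw [LP_append]
        refine ⟨z, ⟨r1, r2, r3, rfl⟩, ?_⟩
        rw [LP_append]
        exact ⟨y0, hrem', hmid, hbu⟩
      · have e : vs ([(i1, i2), (i3, i4), (i5, z)] ++ (rem' ++ ((p0, y1) :: bu)))
          = [i1, i2, i3, i4, i5] ++ (z :: (vs rem' ++ (p0 :: y1 :: vs bu))) := by simp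
        rw [e, List.nodup_append]
        refine ⟨hi, ?_, ?_⟩
        · have : (p0 :: y1 :: p :: y :: q :: z :: (vs rem' ++ vs bu)).Perm
            ([p, y, q] ++ (z :: (vs rem' ++ (p0 :: y1 :: vs bu)))) := by
            classical
            rw [List.perm_iff_count]
            intro a
            simp [List.count_cons, List.count_append]
            ring
          exact (List.nodup_append.1 (this.nodup hbund)).2.1
        · intro a ha b hb hab
          subst hab
          have ha' := hin a ha
          have hbW : a ∉ W := by
            simp only [List.mem_cons, List.mem_append] at hb
            rcases hb with rfl | hb | rfl | rfl | hb
            · exact hW _ (by simp)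
            · exact hW _ (by simp [hb])
            · exact hW _ (by simp)
            · exact hW _ (by simp)
            · exact hbuW _ hb
          simp only [List.nodup_cons, List.mem_cons, not_or, List.mem_append] at hbund hb
          grind
      · simp [hl]; omega
    obtain ⟨c, d, H⟩ := H
    -- common IH application
    have step : ∀ u1 bu1, LP R y1 bu1 u1 → (vs bu1).Perm (vs (bx ++ [(p, y), (q, z)])) →
        bu1.length = bx.length + 2 → (u1 = q ∨ u1 = z) →
        ∀ S1 : Finset V, Link (Bl R) W S1 c d → S1 ⊆ {u, p, y, q, z} → u1 ∉ S1 →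
        ∃ S c u' bu', Ch (Bl R) W (k + 1) S c ∧ S ⊆ insert u (p :: y :: q :: z :: vs rem').toFinset ∧ u' ∉ S ∧
      (u' = u ∨ u' ∈ p :: y :: q :: z :: vs rem') ∧ LP R y1 bu' u' ∧ (vs bu').Perm (p :: y :: q :: z :: (vs rem' ++ vs bx)) ∧
      bu'.length = bx.length + 2 * (k + 1) := by
      intro u1 bu1 h1 h2 h3 h4 S1 hL hS1 hu1
      have hpm : (p0 :: y1 :: (vs rem' ++ vs (bx ++ [(p, y), (q, z)]))).Perm
          (p0 :: y1 :: p :: y :: q :: z :: (vs rem' ++ vs bx)) := by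
        rw [List.perm_iff_count]
        intro a
        simp [List.count_cons, List.count_append]
        ring
      obtain ⟨S, c', u', bu', a1, a2, a3, a4, a5, a6, a7⟩ := ih z rem' (bx ++ [(p, y), (q, z)]) bu1 u1
        (by omega) hrem' (by rw [LP_append]; exact ⟨x, hbx, he, he', rfl⟩) h1
        (hpm.symm.nodup hnd) h2 (by simp [h3]) (by simp; omega)
        (fun v hv => hW v (hpm.subset hv))
      have hu1mem : u1 = q ∨ u1 = z := h4
      have hS1W : ∀ t ∈ S1, t ∉ W := by
        intro t ht
        have := hS1 ht
        simp only [Finset.mem_insert, Finset.mem_singleton] at this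
        rcases this with h | h | h | h | h
        · rw [h]; exact huW
        all_goals (rw [h]; exact hW _ (by simp))
      have hSS : ∀ t ∈ S, t = q ∨ t = z ∨ t ∈ vs rem' := by
        intro t ht
        have := a2 ht
        simp only [Finset.mem_insert, List.mem_toFinset] at this
        rcases this with h | h
        · rw [h]; rcases h4 with h4 | h4
          · exact Or.inl h4
          · exact Or.inr (Or.inl h4)
        · exact Or.inr (Or.inr h)
      have hdis : Disjoint S1 S := by
        rw [Finset.disjoint_left]
        intro t ht ht'
        have b1 := hS1 ht
        have b2 := a2 ht'
        simp only [Finset.mem_insert, Finset.mem_singleton, List.mem_toFinset] at b1 b2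
        rcases b2 with rfl | b2
        · exact hu1 ht
        · simp only [List.nodup_cons, List.mem_cons, not_or, List.mem_append] at hnd
          have : t ∉ vs bx := by
            have := hnd.2.2.2.2.2.2
            exact fun h => List.disjoint_of_nodup_append this b2 h
          grind
      refine ⟨S1 ∪ S, c, u', bu', Ch.cons hL a1 hdis ?_, ?_, ?_, ?_, a5, ?_, ?_⟩
      · rw [Finset.disjoint_left]
        intro t ht
        rcases Finset.mem_union.1 ht with ht | ht
        · exact hS1W t ht
        · rcases hSS t ht with rfl | rfl | h
          · exact hW _ (by simp)
          · exact hW _ (by simp)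
          · exact hW _ (by simp [h])
      · intro t ht
        rcases Finset.mem_union.1 ht with ht | ht
        · have := hS1 ht
          simp only [Finset.mem_insert, Finset.mem_singleton, List.mem_toFinset, List.mem_cons] at this ⊢
          grind
        · have := hSS t ht
          simp only [Finset.mem_insert, List.mem_toFinset, List.mem_cons]
          grind
      · intro ht
        rcases Finset.mem_union.1 ht with ht | ht
        · rcases a4 with rfl | a4
          · exact hu1 ht
          · have := hS1 ht
            simp only [Finset.mem_insert, Finset.mem_singleton] at this
            simp only [List.nodup_cons, List.mem_cons, not_or, List.mem_append] at hnd
            have : u' ∉ vs bx := by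
              have := hnd.2.2.2.2.2.2
              exact fun h => List.disjoint_of_nodup_append this a4 h
            grind
        · exact a3 ht
      · simp only [List.mem_cons]
        rcases a4 with rfl | a4 <;> grind
      · refine a6.trans ?_
        rw [List.perm_iff_count]
        intro a
        simp [List.count_cons, List.count_append]
        ring
      · rw [a7]; simp; ring
    simp only [List.nodup_cons, List.mem_cons, not_or, List.not_mem_nil, not_false_eq_true,
      List.nodup_nil, and_true] at hnd5
    rcases H with H | H
    · refine step z (bx ++ [(p, y), (q, z)]) ?_ (List.Perm.refl _) (by simp) (Or.inr rfl) _ H ?_ ?_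
      · rw [LP_append]; exact ⟨x, hbx, he, he', rfl⟩
      · intro t; simp; grind
      · simp; grind
    · refine step q (bx ++ [(p, y), (z, q)]) ?_ ?_ (by simp) (Or.inl rfl) _ H ?_ ?_
      · rw [LP_append]; exact ⟨x, hbx, he, hs.2 _ _ _ he', rfl⟩
      · simp only [vs_append, vs_cons, vs_nil]
        exact List.Perm.append_left _ (((List.Perm.swap _ _ _).cons _).cons _)
      · intro t; simp; grind
      · simp; grind

theorem nzE {V : Type*} [DecidableEq V] {R : V → V → V → Prop} (hs : SymR R) {n : ℕ}
    (hno : ¬ Cyc R n) {W : Finset V} {y0 p0 y1 b : V} (hmid : R y0 p0 y1) {rest : List (V × V)}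
    (hr : LP R y1 rest y0) (hnd : (p0 :: y1 :: vs rest).Nodup) (hlen : rest.length + 2 = n)
    (hW : ∀ v ∈ p0 :: y1 :: vs rest, v ∉ W) (hb : b ∈ W) (hbr : R p0 y1 b) {k : ℕ} (hk : 1 ≤ k)
    (hkW : k + 2 ≤ W.card) (hkr : 2 * k ≤ rest.length) : Cyc (Bl R) (2 * k + 2) := by
  obtain ⟨bx, rem, rfl, hrem⟩ : ∃ bx rem, rest = bx ++ rem ∧ rem.length = 2 * k :=
    ⟨rest.take (rest.length - 2 * k), rest.drop (rest.length - 2 * k), by simp, by simp; omega⟩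
  rw [LP_append] at hr
  obtain ⟨x, hbx, hrm⟩ := hr
  simp only [List.length_append] at hlen hkr
  simp only [vs_append] at hnd hW
  have hpm : (p0 :: y1 :: (vs rem ++ vs bx)).Perm (p0 :: y1 :: (vs bx ++ vs rem)) :=
    (List.perm_append_comm.cons _).cons _
  have hnd' := hpm.symm.nodup hnd
  have hW' : ∀ v ∈ p0 :: y1 :: (vs rem ++ vs bx), v ∉ W := fun v hv => hW v (hpm.subset hv)
  obtain ⟨S, c, u', bu', a1, a2, a3, a4, a5, a6, a7⟩ := blocks hs hno (W := W) hmid k x rem bx bx x hrem hrm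
    hbx hbx hnd' (List.Perm.refl _) rfl (by omega) hW'
  have hx : x = y1 ∨ x ∈ vs bx := LP_end hbx
  have hSm : ∀ t ∈ S, t = y1 ∨ t ∈ vs rem ++ vs bx := by
    intro t ht
    have := a2 ht
    simp only [Finset.mem_insert, List.mem_toFinset] at this
    rcases this with h | h
    · rw [h]; rcases hx with h | h
      · exact Or.inl h
      · exact Or.inr (by simp [h])
    · exact Or.inr (by simp [h])
  have hu' : u' = y1 ∨ u' ∈ vs rem ++ vs bx := by
    rcases a4 with h | h
    · rw [h]; rcases hx with h | h
      · exact Or.inl h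
      · exact Or.inr (by simp [h])
    · exact Or.inr (by simp [h])
  have hbund : (p0 :: y1 :: vs bu').Nodup := ((a6.cons _).cons _).symm.nodup hnd'
  have hbuW : ∀ v ∈ vs bu', v ∉ W := fun v hv => hW' v (by
    have := a6.subset hv
    exact List.mem_cons_of_mem _ (List.mem_cons_of_mem _ this))
  have hp0W : p0 ∉ W := hW' _ (by simp)
  have hy1W : y1 ∉ W := hW' _ (by simp)
  have hu'W : u' ∉ W := by
    rcases hu' with h | h
    · rw [h]; exact hy1W
    · exact hW' _ (List.mem_cons_of_mem _ (List.mem_cons_of_mem _ h))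
  have hSW : ∀ t ∈ S, t ∉ W := by
    intro t ht
    rcases hSm t ht with h | h
    · rw [h]; exact hy1W
    · exact hW' _ (List.mem_cons_of_mem _ (List.mem_cons_of_mem _ h))
  have hnd2 := hnd'
  rw [List.nodup_cons, List.nodup_cons] at hnd2
  have hp0S : p0 ∉ S := by
    intro h
    rcases hSm _ h with h | h
    · exact hnd2.1 (by simp [h])
    · exact hnd2.1 (List.mem_cons_of_mem _ h)
  have hp0u : p0 ≠ u' := by
    intro h
    rcases hu' with h' | h'
    · exact hnd2.1 (by simp [h, h'])
    · exact hnd2.1 (List.mem_cons_of_mem _ (h ▸ h'))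
  have hndx : ∀ w ∈ W, w ≠ b → ∀ l : List V, l.Perm (w :: b :: p0 :: y1 :: vs bu') → l.Nodup := by
    intro w hw hwb l hl
    refine hl.symm.nodup ?_
    rw [List.nodup_cons, List.nodup_cons]
    simp only [List.mem_cons, not_or]
    refine ⟨⟨hwb, ?_, ?_, ?_⟩, ⟨?_, ?_, ?_⟩, hbund⟩
    · rintro rfl; exact hp0W hw
    · rintro rfl; exact hy1W hw
    · intro h; exact hbuW _ h hw
    · rintro rfl; exact hp0W hb
    · rintro rfl; exact hy1W hb
    · intro h; exact hbuW _ h hb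
  have B1 : ∀ w ∈ W, w ≠ b → Bl R w p0 u' := by
    intro w hw hwb hr
    refine hno ⟨u', [(w, p0), (b, y1)] ++ bu', ?_, ?_, ?_⟩
    · exact ⟨hs.rr hr, hs.2 _ _ _ hbr, a5⟩
    · refine hndx w hw hwb _ ?_
      exact (List.Perm.swap _ _ _).cons _
    · simp; omega
  have B2 : ∀ w ∈ W, w ≠ b → Bl R u' w b := by
    intro w hw hwb hr
    refine hno ⟨u', [(w, b), (p0, y1)] ++ bu', ?_, ?_, ?_⟩
    · exact ⟨hr, hs.rr hbr, a5⟩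
    · exact hndx w hw hwb _ (List.Perm.refl _)
    · simp; omega
  have hTc : (W.erase b).card + 1 = W.card := Finset.card_erase_add_one hb
  obtain ⟨T', hT', hcT, h3⟩ := a1 (W.erase b) (Finset.erase_subset _ _) (by omega)
  obtain ⟨t, ht, htT⟩ : ∃ t ∈ W.erase b, t ∉ T' :=
    Finset.exists_mem_notMem_of_card_lt_card (by omega)
  have hbT : b ∉ T' := fun h => by simpa using hT' h
  have htW : t ∈ W := Finset.mem_of_mem_erase ht
  have htb : t ≠ b := Finset.ne_of_mem_erase ht
  obtain ⟨w0, ws, h0, hs', h0T, hsT, hne, h0c, hB⟩ : ∃ w0 ws, w0 ∈ W ∧ ws ∈ W ∧ w0 ∉ T' ∧ ws ∉ T' ∧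
      ws ≠ w0 ∧ w0 ≠ c ∧ Bl R u' ws w0 := by
    by_cases hbc : b = c
    · exact ⟨t, b, htW, hb, htT, hbT, htb.symm, fun h => htb (h.trans hbc.symm), hs.bl.2 _ _ _ (B2 t htW htb)⟩
    · exact ⟨b, t, hb, htW, hbT, htT, htb, hbc, B2 t htW htb⟩
  obtain ⟨l, e, l1, l2, l3, l4, l5⟩ := h3 w0 h0 h0T h0c
  have he : e ∈ T' := by
    rcases l5 with h | h
    · omega
    · exact h
  have heb := Finset.mem_erase.1 (hT' he)
  have hT'W : ∀ t ∈ T', t ∈ W := fun t ht => Finset.mem_of_mem_erase (hT' ht)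
  refine ⟨w0, l ++ [(p0, u'), (ws, w0)], ?_, ?_, by simp [l4]⟩
  · rw [LP_append]
    exact ⟨e, l1, B1 e heb.2 heb.1, hB, rfl⟩
  · simp only [vs_append, vs_cons, vs_nil]
    rw [List.nodup_append]
    refine ⟨l2, ?_, ?_⟩
    · simp; grind
    · intro a ha b' hb' hab
      have := l3 a ha
      simp at hb'
      grind

theorem nzO {V : Type*} [DecidableEq V] {R : V → V → V → Prop} (hs : SymR R) {n : ℕ}
    (hno : ¬ Cyc R n) {W : Finset V} {y0 p0 y1 a : V} (hmid : R y0 p0 y1) {rest : List (V × V)}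
    (hr : LP R y1 rest y0) (hnd : (p0 :: y1 :: vs rest).Nodup) (hlen : rest.length + 2 = n)
    (hW : ∀ v ∈ p0 :: y1 :: vs rest, v ∉ W) (ha : a ∈ W) (har : R y0 p0 a) {j : ℕ}
    (hkW : j + 3 ≤ W.card) (hkr : 2 * j + 1 ≤ rest.length) : Cyc (Bl R) (2 * j + 3) := by
  have hr0 := hr
  obtain ⟨bx, rem, hrest, hrem⟩ : ∃ bx rem, rest = bx ++ rem ∧ rem.length = 2 * j :=
    ⟨rest.take (rest.length - 2 * j), rest.drop (rest.length - 2 * j), by simp, by simp; omega⟩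
  obtain ⟨⟨q, x1⟩, bx', rfl⟩ : ∃ s bx', bx = s :: bx' := by
    cases bx with
    | nil => simp [hrest] at hkr; omega
    | cons s t => exact ⟨s, t, rfl⟩
  rw [hrest, LP_append] at hr
  obtain ⟨x, hbx, hrm⟩ := hr
  have hvr : vs rest = q :: x1 :: (vs bx' ++ vs rem) := by simp [hrest]
  have hlr : rest.length = bx'.length + 1 + rem.length := by simp [hrest]; omega
  have hpm : (p0 :: y1 :: (vs rem ++ vs ((q, x1) :: bx'))).Perm (p0 :: y1 :: vs rest) := by
    rw [hrest, vs_append]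
    exact (List.perm_append_comm.cons _).cons _
  have hW' : ∀ v ∈ p0 :: y1 :: (vs rem ++ vs ((q, x1) :: bx')), v ∉ W := fun v hv => hW v (hpm.subset hv)
  obtain ⟨S, c, u', bu', a1, a2, -, -, -, -, -⟩ := blocks hs hno (W := W) hmid j x rem
    ((q, x1) :: bx') ((q, x1) :: bx') x hrem hrm
    hbx hbx (hpm.symm.nodup hnd) (List.Perm.refl _) rfl (by simp; omega) hW'
  simp only [LP_cons] at hbx
  obtain ⟨hqr, hbx'⟩ := hbx
  have hx : x = x1 ∨ x ∈ vs bx' := LP_end hbx'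
  have hSm : ∀ t ∈ S, t ∈ x1 :: (vs bx' ++ vs rem) := by
    intro t ht
    have := a2 ht
    simp only [Finset.mem_insert, List.mem_toFinset] at this
    rcases this with h | h
    · rw [h]; rcases hx with h | h
      · simp [h]
      · simp [h]
    · simp [h]
  rw [hvr] at hnd hW
  have hp0W : p0 ∉ W := hW _ (by simp)
  have hy1W : y1 ∉ W := hW _ (by simp)
  have hqW : q ∉ W := hW _ (by simp)
  have hSW : ∀ t ∈ S, t ∉ W := by
    intro t ht
    exact hW _ (List.mem_cons_of_mem _ (List.mem_cons_of_mem _ (List.mem_cons_of_mem _ (hSm t ht))))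
  have hnd2 := hnd
  rw [List.nodup_cons, List.nodup_cons, List.nodup_cons] at hnd2
  obtain ⟨np, ny, nq, nr⟩ := hnd2
  have hqS : q ∉ S := fun h => nq (hSm _ h)
  have hyS : y1 ∉ S := fun h => ny (List.mem_cons_of_mem _ (hSm _ h))
  have hpS : p0 ∉ S := fun h => np (List.mem_cons_of_mem _ (List.mem_cons_of_mem _ (hSm _ h)))
  have hpy : p0 ≠ y1 := fun h => np (by simp [h])
  have hpq : p0 ≠ q := fun h => np (by simp [h])
  have hyq : y1 ≠ q := fun h => ny (by simp [h])
  have hndx : ∀ w ∈ W, w ≠ a → ∀ l : List V,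
      l.Perm (w :: a :: p0 :: y1 :: q :: x1 :: (vs bx' ++ vs rem)) → l.Nodup := by
    intro w hw hwb l hl
    refine hl.symm.nodup ?_
    rw [List.nodup_cons, List.nodup_cons]
    refine ⟨?_, ?_, hnd⟩
    · rw [List.mem_cons, not_or]
      exact ⟨hwb, fun h => hW _ h hw⟩
    · exact fun h => hW _ h ha
  have B1 : ∀ w ∈ W, w ≠ a → Bl R w p0 y1 := by
    intro w hw hwb hr
    refine hno ⟨y0, [(a, p0), (w, y1)] ++ rest, ?_, ?_, ?_⟩
    · exact ⟨hs.2 _ _ _ har, hs.1 _ _ _ hr, hr0⟩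
    · refine hndx w hw hwb _ ?_
      simp only [vs_append, vs_cons, vs_nil, hvr, List.cons_append, List.nil_append]
      rw [List.perm_iff_count]
      intro z
      simp only [List.count_cons]
      ring
    · simp; omega
  have B2 : ∀ w ∈ W, w ≠ a → Bl R y1 w a := by
    intro w hw hwb hr
    refine hno ⟨y0, [(p0, a), (w, y1)] ++ rest, ?_, ?_, ?_⟩
    · exact ⟨har, hs.s13 hr, hr0⟩
    · refine hndx w hw hwb _ ?_
      simp only [vs_append, vs_cons, vs_nil, hvr, List.cons_append, List.nil_append]
      rw [List.perm_iff_count]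
      intro z
      simp only [List.count_cons]
      ring
    · simp; omega
  have B3 : ∀ w ∈ W, w ≠ a → Bl R a q w := by
    intro w hw hwb hr
    refine hno ⟨y0, [(p0, a), (w, q), (y1, x1)] ++ (bx' ++ rem), ?_, ?_, ?_⟩
    · rw [LP_append]
      refine ⟨x1, ⟨har, hs.2 _ _ _ hr, hs.1 _ _ _ hqr, rfl⟩, ?_⟩
      rw [LP_append]
      exact ⟨x, hbx', hrm⟩
    · refine hndx w hw hwb _ ?_
      simp only [vs_append, vs_cons, vs_nil, List.cons_append, List.nil_append]
      rw [List.perm_iff_count]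
      intro z
      simp only [List.count_cons]
      ring
    · simp; omega
  have hTc : (W.erase a).card + 1 = W.card := Finset.card_erase_add_one ha
  obtain ⟨T', hT', hcT, h3⟩ := a1 (W.erase a) (Finset.erase_subset _ _) (by omega)
  have hcard : 1 < (W.erase a \ T').card := by
    have := Finset.card_sdiff_add_card_eq_card hT'
    omega
  obtain ⟨t1, ht1, t2, ht2, ht12⟩ := Finset.one_lt_card.1 hcard
  simp only [Finset.mem_sdiff, Finset.mem_erase] at ht1 ht2
  have haT : a ∉ T' := fun h => by simpa using hT' h
  obtain ⟨w0, ws, h0, hs', h0T, hsT, hne, h0c, h0a, hsa⟩ : ∃ w0 ws, w0 ∈ W ∧ ws ∈ W ∧ w0 ∉ T' ∧ ws ∉ T' ∧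
      ws ≠ w0 ∧ w0 ≠ c ∧ w0 ≠ a ∧ ws ≠ a := by
    by_cases hbc : t1 = c
    · exact ⟨t2, t1, ht2.1.2, ht1.1.2, ht2.2, ht1.2, ht12, fun h => ht12 (hbc.trans h.symm), ht2.1.1, ht1.1.1⟩
    · exact ⟨t1, t2, ht1.1.2, ht2.1.2, ht1.2, ht2.2, ht12.symm, hbc, ht1.1.1, ht2.1.1⟩
  obtain ⟨l, e, l1, l2, l3, l4, l5⟩ := h3 w0 h0 h0T h0c
  have he : e ∈ W ∧ e ≠ a := by
    rcases l5 with h | h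
    · rw [h.2]; exact ⟨h0, h0a⟩
    · have := Finset.mem_erase.1 (hT' h)
      exact ⟨this.2, this.1⟩
  have hT'W : ∀ t ∈ T', t ∈ W := fun t ht => Finset.mem_of_mem_erase (hT' ht)
  refine ⟨w0, l ++ [(p0, y1), (ws, a), (q, w0)], ?_, ?_, by simp [l4]⟩
  · rw [LP_append]
    exact ⟨e, l1, B1 e he.1 he.2, B2 ws hs' hsa, B3 w0 h0 h0a, rfl⟩
  · simp only [vs_append, vs_cons, vs_nil]
    rw [List.nodup_append]
    refine ⟨l2, ?_, ?_⟩
    · simp; grind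
    · intro z hz b' hb' hab
      have := l3 z hz
      simp only [List.mem_cons, List.not_mem_nil, or_false] at hb'
      have hzW : z ∈ S → z ∉ W := fun h => hSW z h
      rcases this with h | h
      · have := hT'W z h
        grind
      · grind

theorem dich {V : Type*} {R : V → V → V → Prop} (hs : SymR R) (W : Finset V) {l : List (V × V)} {x z : V}
    (h : LP R x l z) :
    (∃ l1 x' p y l2, l = l1 ++ (p, y) :: l2 ∧ LP R x l1 x' ∧ R x' p y ∧ LP R y l2 z ∧
      ∃ w ∈ W, R x' p w ∨ R p y w) ∨
    List.IsChain (fun a b => ∀ w ∈ W, Bl R a b w) (x :: vs l) := by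
  induction l generalizing x with
  | nil => right; simp
  | cons s l ih =>
    obtain ⟨p, y⟩ := s
    simp only [LP_cons] at h
    by_cases hw : ∃ w ∈ W, R x p w ∨ R p y w
    · left
      exact ⟨[], x, p, y, l, rfl, rfl, h.1, h.2, hw⟩
    · rcases ih h.2 with ⟨l1, x', p', y', l2, e, h1, h2, h3, h4⟩ | h'
      · left
        exact ⟨(p, y) :: l1, x', p', y', l2, by simp [e], ⟨h.1, h1⟩, h2, h3, h4⟩
      · right
        push Not at hw
        simp only [vs_cons, List.isChain_cons_cons]
        exact ⟨fun w hwW => (hw w hwW).1, fun w hwW => (hw w hwW).2, h'⟩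

theorem zeroCh {V : Type*} [DecidableEq V] {B : V → V → V → Prop} (hs : SymR B) {W : Finset V} (c : V) :
    ∀ (r : ℕ) (L : List V), List.IsChain (fun a b => ∀ w ∈ W, B a b w) L → L.Nodup →
    (∀ v ∈ L, v ∉ W) → 3 * r ≤ L.length → Ch B W r L.toFinset c := by
  intro r
  induction r with
  | zero => intro L _ _ _ _; exact Ch.zero _ _ _ _
  | succ r ih =>
    intro L hL hnd hW hlen
    match L, hL, hnd, hW, hlen with
    | [], _, _, _, hlen => simp at hlen
    | [_], _, _, _, hlen => simp at hlen; omega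
    | [_, _], _, _, _, hlen => simp at hlen; omega
    | a :: b :: d :: L', hL, hnd, hW, hlen =>
    simp only [List.isChain_cons_cons] at hL
    have hL' : List.IsChain (fun a b => ∀ w ∈ W, B a b w) L' := hL.2.2.tail
    simp only [List.nodup_cons, List.mem_cons, not_or] at hnd
    have h := ih L' hL' hnd.2.2.2 (fun v hv => hW v (by simp [hv])) (by simp at hlen; omega)
    have hlink : Link B W {a, b, d} c c := by
      intro w hw w' hw' _ _ _
      exact ⟨a, by simp, b, by simp, d, by simp, hnd.1.1, hnd.1.2.1, hnd.2.1.1,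
        hs.rr (hL.1 w hw), hL.2.1 w' hw'⟩
    have := Ch.cons hlink h (by
      rw [Finset.disjoint_left]
      intro t ht ht'
      simp only [Finset.mem_insert, Finset.mem_singleton, List.mem_toFinset] at ht ht'
      grind) (by
      rw [Finset.disjoint_left]
      intro t ht
      apply hW
      simp only [Finset.mem_union, Finset.mem_insert, Finset.mem_singleton, List.mem_toFinset] at ht
      simp only [List.mem_cons]
      grind)
    refine this.mono ?_
    intro t ht
    simp only [Finset.mem_union, Finset.mem_insert, Finset.mem_singleton, List.mem_toFinset] at ht
    simp only [List.mem_toFinset, List.mem_cons]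
    grind

theorem zeroWalk {V : Type*} [DecidableEq V] {B : V → V → V → Prop} (hs : SymR B) {W T : Finset V}
    (hT : T ⊆ W) {r : ℕ} {L : List V} (hL : List.IsChain (fun a b => ∀ w ∈ W, B a b w) L)
    (hnd : L.Nodup) (hW : ∀ v ∈ L, v ∉ W) (hlen : 3 * r ≤ L.length) (hr : r + 1 ≤ T.card)
    {c : V} (hc : c ∉ W) :
    ∃ T' ⊆ T, T'.card = r ∧ ∀ w0 ∈ W, w0 ∉ T' → ∃ l e, LP B w0 l e ∧ (vs l).Nodup ∧
      (∀ v ∈ vs l, v ∈ T' ∨ v ∈ L) ∧ l.length = 2 * r ∧ e ∈ W ∧ (1 ≤ r → e ∈ T') := by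
  obtain ⟨T', h1, h2, h3⟩ := zeroCh hs c r L hL hnd hW hlen T hT hr
  refine ⟨T', h1, h2, fun w0 hw0 hw0T => ?_⟩
  obtain ⟨l, e, l1, l2, l3, l4, l5⟩ := h3 w0 hw0 hw0T (fun h => hc (h ▸ hw0))
  refine ⟨l, e, l1, l2, fun v hv => (l3 v hv).imp id (fun h => by simpa using h), l4, ?_, ?_⟩
  · rcases l5 with h | h
    · rw [h.2]; exact hw0
    · exact hT (h1 h)
  · intro hr
    rcases l5 with h | h
    · omega
    · exact h

theorem zeroE {V : Type*} [DecidableEq V] {B : V → V → V → Prop} (hs : SymR B) {W : Finset V}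
    {k : ℕ} {L : List V} (hL : List.IsChain (fun a b => ∀ w ∈ W, B a b w) L)
    (hnd : L.Nodup) (hW : ∀ v ∈ L, v ∉ W) (hlen : 3 * k + 3 ≤ L.length) (hk : k + 1 ≤ W.card) :
    Cyc B (2 * k + 2) := by
  match L, hL, hnd, hW, hlen with
  | [], _, _, _, hlen => simp at hlen
  | [_], _, _, _, hlen => simp at hlen
  | [_, _], _, _, _, hlen => simp at hlen
  | a :: b :: d :: L', hL, hnd, hW, hlen =>
  simp only [List.isChain_cons_cons] at hL
  have hL' : List.IsChain (fun a b => ∀ w ∈ W, B a b w) L' := hL.2.2.tail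
  simp only [List.nodup_cons, List.mem_cons, not_or] at hnd
  obtain ⟨T', h1, h2, h3⟩ := zeroWalk hs (Finset.Subset.refl W) hL' hnd.2.2.2
    (fun v hv => hW v (by simp [hv])) (by simp at hlen; omega) hk (c := a) (hW a (by simp))
  obtain ⟨w0, hw0, hw0T⟩ : ∃ t ∈ W, t ∉ T' :=
    Finset.exists_mem_notMem_of_card_lt_card (by omega)
  obtain ⟨l, e, l1, l2, l3, l4, l5, l6⟩ := h3 w0 hw0 hw0T
  have ha := hW a (by simp)
  have hb := hW b (by simp)
  have hd := hW d (by simp)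
  have hL'W : ∀ v ∈ L', v ∉ W := fun v hv => hW v (by simp [hv])
  refine ⟨w0, l ++ [(a, b), (d, w0)], ?_, ?_, by simp [l4]⟩
  · rw [LP_append]
    exact ⟨e, l1, hs.rr (hL.1 e l5), hL.2.1 w0 hw0, rfl⟩
  · simp only [vs_append, vs_cons, vs_nil]
    rw [List.nodup_append]
    refine ⟨l2, ?_, ?_⟩
    · simp; grind
    · intro z hz b' hb' hab
      simp only [List.mem_cons, List.not_mem_nil, or_false] at hb'
      rcases l3 z hz with h | h
      · have := h1 h
        grind
      · have := hL'W z h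
        grind

theorem zeroO {V : Type*} [DecidableEq V] {B : V → V → V → Prop} (hs : SymR B) {W : Finset V}
    {j : ℕ} {L : List V} (hL : List.IsChain (fun a b => ∀ w ∈ W, B a b w) L)
    (hnd : L.Nodup) (hW : ∀ v ∈ L, v ∉ W) (hlen : 3 * j + 3 ≤ L.length) (hk : j + 3 ≤ W.card)
    {x w w' : V} (hx : x ∉ W) (hxL : x ∉ L) (hw : w ∈ W) (hw' : w' ∈ W) (hne : w ≠ w') (hB : B x w w') :
    Cyc B (2 * j + 3) := by
  match L, hL, hnd, hW, hlen with
  | [], _, _, _, hlen => simp at hlen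
  | [_], _, _, _, hlen => simp at hlen
  | [_, _], _, _, _, hlen => simp at hlen
  | a :: b :: d :: L', hL, hnd, hW, hlen =>
  simp only [List.isChain_cons_cons] at hL
  have hL' : List.IsChain (fun a b => ∀ w ∈ W, B a b w) L' := hL.2.2.tail
  simp only [List.nodup_cons, List.mem_cons, not_or] at hnd hxL
  have hTW : (W.erase w).erase w' ⊆ W := (Finset.erase_subset _ _).trans (Finset.erase_subset _ _)
  have hc1 := Finset.card_erase_add_one hw
  have hc2 := Finset.card_erase_add_one (s := W.erase w) (a := w') (by simp [hw', hne.symm])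
  obtain ⟨T', h1, h2, h3⟩ := zeroWalk hs hTW hL' hnd.2.2.2 (r := j)
    (fun v hv => hW v (by simp [hv])) (by simp at hlen; omega) (by omega) (c := a) (hW a (by simp))
  have hwT : w ∉ T' := fun h => by have := h1 h; simp at this
  have hwT' : w' ∉ T' := fun h => by have := h1 h; simp at this
  obtain ⟨l, e, l1, l2, l3, l4, l5, l6⟩ := h3 w hw hwT
  have ha := hW a (by simp)
  have hb := hW b (by simp)
  have hd := hW d (by simp)
  have hL'W : ∀ v ∈ L', v ∉ W := fun v hv => hW v (by simp [hv])
  refine ⟨w, l ++ [(a, b), (d, w'), (x, w)], ?_, ?_, by simp [l4]⟩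
  · rw [LP_append]
    exact ⟨e, l1, hs.rr (hL.1 e l5), hL.2.1 w' hw', hs.rr hB, rfl⟩
  · simp only [vs_append, vs_cons, vs_nil]
    rw [List.nodup_append]
    refine ⟨l2, ?_, ?_⟩
    · simp; grind
    · intro z hz b' hb' hab
      simp only [List.mem_cons, List.not_mem_nil, or_false] at hb'
      rcases l3 z hz with h | h
      · have := hTW (h1 h)
        grind
      · have := hL'W z h
        grind

theorem zeroO2 {V : Type*} [DecidableEq V] {B : V → V → V → Prop} (hs : SymR B) {W : Finset V}
    {k : ℕ} {L : List V} (hL : List.IsChain (fun a b => ∀ w ∈ W, B a b w) L)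
    (hnd : L.Nodup) (hW : ∀ v ∈ L, v ∉ W) (hlen : 3 * k ≤ L.length) (hk : k + 1 ≤ W.card) (hk1 : 1 ≤ k)
    {x : V} (hx : x ∉ W) (hxL : x ∉ L) (hB : ∀ w ∈ W, ∀ w' ∈ W, w ≠ w' → B w x w') :
    Cyc B (2 * k + 1) := by
  obtain ⟨T', h1, h2, h3⟩ := zeroWalk hs (Finset.Subset.refl W) hL hnd hW hlen hk hx
  obtain ⟨w0, hw0, hw0T⟩ : ∃ t ∈ W, t ∉ T' :=
    Finset.exists_mem_notMem_of_card_lt_card (by omega)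
  obtain ⟨l, e, l1, l2, l3, l4, l5, l6⟩ := h3 w0 hw0 hw0T
  have he := l6 hk1
  refine ⟨w0, l ++ [(x, w0)], ?_, ?_, by simp [l4]⟩
  · rw [LP_append]
    exact ⟨e, l1, hB e l5 w0 hw0 (fun h => hw0T (h ▸ he)), rfl⟩
  · simp only [vs_append, vs_cons, vs_nil]
    rw [List.nodup_append]
    refine ⟨l2, ?_, ?_⟩
    · simp; grind
    · intro z hz b' hb' hab
      simp only [List.mem_cons, List.not_mem_nil, or_false] at hb'
      rcases l3 z hz with h | h
      · have := h1 h
        grind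
      · have := hW z h
        grind

theorem zeroPO {V : Type*} [DecidableEq V] {B : V → V → V → Prop} (hs : SymR B) {W : Finset V}
    {k : ℕ} {L : List V} (hL : List.IsChain (fun a b => ∀ w ∈ W, B a b w) L)
    (hnd : L.Nodup) (hW : ∀ v ∈ L, v ∉ W) (hlen : 3 * k + 2 ≤ L.length) (hk : k + 1 ≤ W.card) :
    Pth B (2 * k + 1) := by
  match L, hL, hnd, hW, hlen with
  | [], _, _, _, hlen => simp at hlen
  | [_], _, _, _, hlen => simp at hlen
  | a :: b :: L', hL, hnd, hW, hlen =>
  simp only [List.isChain_cons_cons] at hL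
  have hL' : List.IsChain (fun a b => ∀ w ∈ W, B a b w) L' := hL.2.tail
  simp only [List.nodup_cons, List.mem_cons, not_or] at hnd
  obtain ⟨T', h1, h2, h3⟩ := zeroWalk hs (Finset.Subset.refl W) hL' hnd.2.2
    (fun v hv => hW v (by simp [hv])) (by simp at hlen; omega) hk (c := a) (hW a (by simp))
  obtain ⟨w0, hw0, hw0T⟩ : ∃ t ∈ W, t ∉ T' :=
    Finset.exists_mem_notMem_of_card_lt_card (by omega)
  obtain ⟨l, e, l1, l2, l3, l4, l5, l6⟩ := h3 w0 hw0 hw0T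
  have ha := hW a (by simp)
  have hb := hW b (by simp)
  have hL'W : ∀ v ∈ L', v ∉ W := fun v hv => hW v (by simp [hv])
  refine ⟨w0, b, l ++ [(a, b)], ?_, ?_, by simp [l4]⟩
  · rw [LP_append]
    exact ⟨e, l1, hs.rr (hL.1 e l5), rfl⟩
  · have hp : (w0 :: vs (l ++ [(a, b)])).Perm (vs l ++ [a, b, w0]) := by
      rw [List.perm_iff_count]; intro z
      simp [List.count_cons]; ring
    refine hp.symm.nodup ?_
    rw [List.nodup_append]
    refine ⟨l2, ?_, ?_⟩
    · simp; grind
    · intro z hz b' hb' hab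
      simp only [List.mem_cons, List.not_mem_nil, or_false] at hb'
      rcases l3 z hz with h | h
      · have := h1 h
        grind
      · have := hL'W z h
        grind

theorem zeroPE {V : Type*} [DecidableEq V] {B : V → V → V → Prop} (hs : SymR B) {W : Finset V}
    {k : ℕ} {L : List V} (hL : List.IsChain (fun a b => ∀ w ∈ W, B a b w) L)
    (hnd : L.Nodup) (hW : ∀ v ∈ L, v ∉ W) (hlen : 3 * k + 4 ≤ L.length) (hk : k + 1 ≤ W.card) :
    Pth B (2 * k + 2) := by
  match L, hL, hnd, hW, hlen with
  | [], _, _, _, hlen => simp at hlen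
  | [_], _, _, _, hlen => simp at hlen
  | [_, _], _, _, _, hlen => simp at hlen
  | [_, _, _], _, _, _, hlen => simp at hlen
  | a :: b :: v :: v' :: L', hL, hnd, hW, hlen =>
  simp only [List.isChain_cons_cons] at hL
  have hL' : List.IsChain (fun a b => ∀ w ∈ W, B a b w) L' := hL.2.2.2.tail
  simp only [List.nodup_cons, List.mem_cons, not_or] at hnd
  obtain ⟨T', h1, h2, h3⟩ := zeroWalk hs (Finset.Subset.refl W) hL' hnd.2.2.2.2
    (fun v hv => hW v (by simp [hv])) (by simp at hlen; omega) hk (c := a) (hW a (by simp))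
  obtain ⟨w0, hw0, hw0T⟩ : ∃ t ∈ W, t ∉ T' :=
    Finset.exists_mem_notMem_of_card_lt_card (by omega)
  obtain ⟨l, e, l1, l2, l3, l4, l5, l6⟩ := h3 w0 hw0 hw0T
  have ha := hW a (by simp)
  have hb := hW b (by simp)
  have hv := hW v (by simp)
  have hv' := hW v' (by simp)
  have hL'W : ∀ v ∈ L', v ∉ W := fun v hv => hW v (by simp [hv])
  refine ⟨v, b, (v', w0) :: (l ++ [(a, b)]), ?_, ?_, by simp [l4]⟩
  · refine ⟨hL.2.2.1 w0 hw0, ?_⟩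
    rw [LP_append]
    exact ⟨e, l1, hs.rr (hL.1 e l5), rfl⟩
  · have hp : (v :: vs ((v', w0) :: (l ++ [(a, b)]))).Perm (vs l ++ [a, b, w0, v, v']) := by
      rw [List.perm_iff_count]; intro z
      simp [List.count_cons]; ring
    refine hp.symm.nodup ?_
    rw [List.nodup_append]
    refine ⟨l2, ?_, ?_⟩
    · simp; grind
    · intro z hz b' hb' hab
      simp only [List.mem_cons, List.not_mem_nil, or_false] at hb'
      rcases l3 z hz with h | h
      · have := h1 h
        grind
      · have := hL'W z h
        grind

theorem LP_last {V : Type*} {R : V → V → V → Prop} {l : List (V × V)} {x z : V}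
    (h : LP R x l z) (hl : l ≠ []) : ∃ l' p x', l = l' ++ [(p, z)] ∧ LP R x l' x' ∧ R x' p z := by
  obtain ⟨l', ⟨p, y⟩, rfl⟩ : ∃ l' s, l = l' ++ [s] := ⟨_, _, (List.dropLast_append_getLast hl).symm⟩
  rw [LP_append] at h
  obtain ⟨x', h1, h2, h3⟩ := h
  simp only [LP_nil] at h3
  subst h3
  exact ⟨l', p, x', rfl, h1, h2⟩

theorem step {V : Type*} [DecidableEq V] {R : V → V → V → Prop} (hs : SymR R) {n m : ℕ}
    (hm : 3 ≤ m) (hmn : m ≤ n) (hno : ¬ Cyc R n) {W : Finset V} {x : V} {l : List (V × V)}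
    (hl : LP R x l x) (hnd : (vs l).Nodup) (hlen : l.length + 1 = n) (hW : ∀ v ∈ vs l, v ∉ W)
    (hWc : (m + 1) / 2 + 1 ≤ W.card) : Cyc (Bl R) m := by
  by_cases nz : ∃ y0 p0 y1 rest, R y0 p0 y1 ∧ LP R y1 rest y0 ∧ (p0 :: y1 :: vs rest).Nodup ∧
      rest.length + 2 = n ∧ (∀ v ∈ p0 :: y1 :: vs rest, v ∉ W) ∧ ∃ b ∈ W, R y0 p0 b ∨ R p0 y1 b
  · obtain ⟨y0, p0, y1, rest, h1, h2, h3, h4, h5, b, hb, hr⟩ := nz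
    obtain ⟨rest', g2, g4, g⟩ := LP_rev hs h2
    have g1 := hs.s13 h1
    have gp : (p0 :: y0 :: vs rest').Perm (p0 :: y1 :: vs rest) := (g.symm).cons _
    have g3 := gp.symm.nodup h3
    have g5 : ∀ v ∈ p0 :: y0 :: vs rest', v ∉ W := fun v hv => h5 v (gp.subset hv)
    rcases Nat.even_or_odd' m with ⟨c, rfl | rfl⟩
    · obtain ⟨k, rfl⟩ : ∃ k, c = k + 1 := ⟨c - 1, by omega⟩
      rw [mul_add]
      rcases hr with hr | hr
      · exact nzE hs hno g1 g2 g3 (by omega) g5 hb (hs.1 _ _ _ hr) (by omega) (by omega) (by omega)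
      · exact nzE hs hno h1 h2 h3 (by omega) h5 hb hr (by omega) (by omega) (by omega)
    · obtain ⟨j, rfl⟩ : ∃ j, c = j + 1 := ⟨c - 1, by omega⟩
      rw [mul_add]
      rcases hr with hr | hr
      · exact nzO hs hno h1 h2 h3 (by omega) h5 hb hr (by omega) (by omega)
      · exact nzO hs hno g1 g2 g3 (by omega) g5 hb (hs.1 _ _ _ hr) (by omega) (by omega)
  · have chain : ∀ (x : V) (l : List (V × V)), LP R x l x → (vs l).Nodup → l.length + 1 = n →
        (∀ v ∈ vs l, v ∉ W) → List.IsChain (fun a b => ∀ w ∈ W, Bl R a b w) (x :: vs l) := by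
      intro x l hl hnd hlen hW
      rcases dich hs W hl with ⟨l1, x', p, y, l2, e, h1, h2, h3, h4⟩ | h
      · exfalso
        have hp : (p :: y :: vs (l2 ++ l1)).Perm (vs l) := by
          rw [e, List.perm_iff_count]; intro z
          simp [List.count_cons]; ring
        refine nz ⟨x', p, y, l2 ++ l1, h2, ?_, hp.symm.nodup hnd, ?_, fun v hv => hW v (hp.subset hv), h4⟩
        · rw [LP_append]; exact ⟨x, h3, h1⟩
        · rw [← hlen, e]; simp; ring
      · exact h
    rcases Nat.even_or_odd' m with ⟨c, rfl | rfl⟩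
    · obtain ⟨k, rfl⟩ : ∃ k, c = k + 1 := ⟨c - 1, by omega⟩
      rw [mul_add]
      refine zeroE hs.bl (chain x l hl hnd hlen hW).tail hnd hW ?_ (by omega)
      simp only [List.tail_cons, vs_length]; omega
    · obtain ⟨j, rfl⟩ : ∃ j, c = j + 1 := ⟨c - 1, by omega⟩
      rw [mul_add]
      have fin : ∀ (x : V) (l : List (V × V)), LP R x l x → (vs l).Nodup → l.length + 1 = n →
        (∀ v ∈ vs l, v ∉ W) → ∀ w ∈ W, ∀ w' ∈ W, w ≠ w' → ¬ R x w w' → Cyc (Bl R) (2 * j + 3) := by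
        intro x l hl hnd hlen hW w hw w' hw' hne hB
        have hch := (chain x l hl hnd hlen hW).tail
        obtain ⟨l', p, x', rfl, q1, q2⟩ := LP_last hl (by rintro rfl; simp at hlen; omega)
        have e : vs (l' ++ [(p, x)]) = (vs l' ++ [p]) ++ [x] := by simp
        rw [List.tail_cons, e] at hch
        have hlv : (vs (l' ++ [(p, x)])).length = 2 * (n - 1) := by rw [vs_length]; omega
        rw [e] at hnd hW hlv
        have hnd' := hnd
        rw [List.nodup_append] at hnd
        refine zeroO hs.bl hch.left_of_append hnd.1
          (fun v hv => hW v (List.mem_append_left _ hv)) ?_ (by omega) (x := x) (hW x (by simp)) ?_ hw hw' hne hB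
        · rw [List.length_append] at hlv; simp only [List.length_singleton] at hlv; omega
        · intro h; exact hnd.2.2 x h x (by simp) rfl
      obtain ⟨⟨p, y⟩, rest, rfl⟩ : ∃ s rest, l = s :: rest := by
        cases l with
        | nil => simp at hlen; omega
        | cons s t => exact ⟨s, t, rfl⟩
      obtain ⟨w1, h1, w2, h2, w3, h3, n12, n13, n23⟩ : ∃ w1 ∈ W, ∃ w2 ∈ W, ∃ w3 ∈ W, w1 ≠ w2 ∧ w1 ≠ w3 ∧ w2 ≠ w3 := by
        obtain ⟨a, b, c, h⟩ := (Finset.two_lt_card_iff (s := W)).1 (by omega)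
        exact ⟨a, h.1, b, h.2.1, c, h.2.2.1, h.2.2.2⟩
      by_cases b1 : R x w1 w2
      · by_cases b2 : R y w2 w3
        · exfalso
          simp only [LP_cons] at hl
          refine hno ⟨x, [(w1, w2), (w3, y)] ++ rest, ⟨b1, hs.rl b2, hl.2⟩, ?_, ?_⟩
          · simp only [vs_cons, List.nodup_cons, List.mem_cons, not_or, List.cons_append, List.nil_append] at hnd hW ⊢
            refine ⟨⟨n12, n13, ?_, ?_⟩, ⟨n23, ?_, ?_⟩, ⟨?_, ?_⟩, hnd.2⟩
            · rintro rfl; exact hW _ (by simp) h1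
            · intro h; exact hW _ (by simp [h]) h1
            · rintro rfl; exact hW _ (by simp) h2
            · intro h; exact hW _ (by simp [h]) h2
            · rintro rfl; exact hW _ (by simp) h3
            · intro h; exact hW _ (by simp [h]) h3
          · simp at hlen ⊢; omega
        · have hp : (vs (rest ++ [(p, y)])).Perm (vs ((p, y) :: rest)) := by
            rw [List.perm_iff_count]; intro z
            simp [List.count_cons]; ring
          refine fin y (rest ++ [(p, y)]) ?_ (hp.symm.nodup hnd) ?_ (fun v hv => hW v (hp.subset hv)) w2 h2 w3 h3 n23 b2
          · rw [LP_append]; exact ⟨x, hl.2, hl.1, rfl⟩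
          · simpa using hlen
      · exact fin x _ hl hnd hlen hW w1 h1 w2 h2 n12 b1

theorem comp_card {V : Type*} [DecidableEq V] [Fintype V] {l : List (V × V)} (hnd : (vs l).Nodup) :
    (Finset.univ \ (vs l).toFinset).card + 2 * l.length = Fintype.card V := by
  have h := Finset.card_sdiff_add_card_eq_card (Finset.subset_univ (vs l).toFinset)
  rw [List.toFinset_card_of_nodup hnd, vs_length, Finset.card_univ] at h
  exact h

theorem step' {V : Type*} [DecidableEq V] [Fintype V] {R : V → V → V → Prop} (hs : SymR R) {n m : ℕ}
    (hm : 3 ≤ m) (hmn : m ≤ n) (hV : 2 * n + (m + 1) / 2 - 1 ≤ Fintype.card V)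
    (hc : Cyc R (n - 1)) : Cyc R n ∨ Cyc (Bl R) m := by
  by_cases hno : Cyc R n
  · exact Or.inl hno
  right
  obtain ⟨x, l, hl, hnd, hlen⟩ := hc
  have := comp_card hnd
  refine step hs hm hmn hno hl hnd (by omega) (W := Finset.univ \ (vs l).toFinset) ?_ (by omega)
  intro v hv; simp [hv]

theorem T {V : Type*} [DecidableEq V] [Fintype V] : ∀ (s n m : ℕ) (R : V → V → V → Prop), SymR R → n + m = s → 3 ≤ m → m ≤ n →
    2 * n + (m + 1) / 2 - 1 ≤ Fintype.card V → Cyc R n ∨ Cyc (Bl R) m := by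
  intro s
  induction s using Nat.strong_induction_on with
  | _ s ih =>
  intro n m R hs hsum hm hmn hV
  have blcase : m = n → Cyc (Bl R) (n - 1) → Cyc R n ∨ Cyc (Bl R) m := by
    rintro rfl h
    have := step' hs.bl hm le_rfl hV h
    rw [bl_bl] at this
    exact this.symm
  rcases Nat.lt_or_ge m n with h | h
  · rcases ih (n - 1 + m) (by omega) (n - 1) m R hs rfl hm (by omega) (by omega) with h | h
    · exact step' hs hm hmn hV h
    · exact Or.inr h
  · obtain rfl : m = n := by omega
    rcases Nat.lt_or_ge 3 m with h3 | h3
    · rcases ih (m + (m - 1)) (by omega) m (m - 1) R hs rfl (by omega) (by omega) (by omega) with h | h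
      · exact Or.inl h
      · exact blcase rfl h
    · obtain rfl : m = 3 := by omega
      obtain ⟨S, hS⟩ := Finset.exists_subset_card_eq (s := (Finset.univ : Finset V)) (n := 4) (by
        rw [Finset.card_univ]; omega)
      obtain ⟨a, b, c, d, h1, h2, h3, h4, h5, h6, -⟩ := Finset.card_eq_four.1 hS.2
      have mk : ∀ (Q : V → V → V → Prop), SymR Q → ∀ x p y q, [p, y, q, x].Nodup → Q x p y → Q y q x → Cyc Q 2 := by
        intro Q _ x p y q hn e1 e2
        exact ⟨x, [(p, y), (q, x)], ⟨e1, e2, rfl⟩, hn, rfl⟩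
      have red : Cyc R 2 → Cyc R 3 ∨ Cyc (Bl R) 3 := fun h => step' hs hm le_rfl hV h
      have blu : Cyc (Bl R) 2 → Cyc R 3 ∨ Cyc (Bl R) 3 := fun h => blcase rfl h
      have n1 : [c, b, d, a].Nodup := by simp; grind
      have n2 : [b, c, d, a].Nodup := by simp; grind
      have n3 : [b, d, c, a].Nodup := by simp; grind
      by_cases r1 : R a b c
      · by_cases r2 : R a b d
        · exact red (mk R hs a c b d n1 (hs.2 _ _ _ r1) (hs.rl r2 |> hs.2 _ _ _ |> hs.2 _ _ _))
        · by_cases r3 : R a c d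
          · exact red (mk R hs a b c d n2 r1 (hs.rl r3))
          · exact blu (mk _ hs.bl a b d c n3 r2 (hs.bl.s13 r3))
      · by_cases r2 : R a b d
        · by_cases r3 : R a c d
          · exact red (mk R hs a b d c n3 r2 (hs.s13 r3))
          · exact blu (mk _ hs.bl a b c d n2 r1 (hs.bl.rl r3))
        · exact blu (mk _ hs.bl a c b d n1 (hs.bl.2 _ _ _ r1) (hs.bl.rl r2))

theorem path_of_cyc {V : Type*} [DecidableEq V] [Fintype V] {R : V → V → V → Prop} (hs : SymR R) {n m : ℕ}
    (hm : 3 ≤ m) (hmn : m ≤ n) (hV : 2 * n + (m + 1) / 2 ≤ Fintype.card V)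
    (hc : Cyc R n) : Pth R n ∨ (Cyc (Bl R) m ∧ Pth (Bl R) m) := by
  by_cases hno : Pth R n
  · exact Or.inl hno
  right
  obtain ⟨x, l, hl, hnd, hlen⟩ := hc
  have hWc := comp_card hnd
  have hW : ∀ v ∈ vs l, v ∉ Finset.univ \ (vs l).toFinset := by intro v hv; simp [hv]
  generalize Finset.univ \ (vs l).toFinset = W at hWc hW
  have hch : List.IsChain (fun a b => ∀ w ∈ W, Bl R a b w) (vs l) := by
    rcases dich hs W hl with ⟨l1, x', p, y, l2, e, h1, h2, h3, w, hw, h4⟩ | h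
    · exfalso
      apply hno
      have hwl : w ∉ vs l := fun h => hW w h hw
      have hlp : LP R y (l2 ++ l1) x' := by rw [LP_append]; exact ⟨x, h3, h1⟩
      rcases h4 with h4 | h4
      · refine ⟨y, w, (l2 ++ l1) ++ [(p, w)], ?_, ?_, ?_⟩
        · rw [LP_append]; exact ⟨x', hlp, h4, rfl⟩
        · have hp : (y :: vs ((l2 ++ l1) ++ [(p, w)])).Perm (w :: vs l) := by
            rw [e, List.perm_iff_count]; intro z
            simp [List.count_cons]; ring
          exact hp.symm.nodup (List.nodup_cons.2 ⟨hwl, hnd⟩)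
        · rw [← hlen, e]; simp; ring
      · refine ⟨w, x', (p, y) :: (l2 ++ l1), ⟨hs.rr h4, hlp⟩, ?_, ?_⟩
        · have hp : (w :: vs ((p, y) :: (l2 ++ l1))).Perm (w :: vs l) := by
            rw [e, List.perm_iff_count]; intro z
            simp [List.count_cons]; ring
          exact hp.symm.nodup (List.nodup_cons.2 ⟨hwl, hnd⟩)
        · rw [← hlen, e]; simp; ring
    · exact h.tail
  have hvl : (vs l).length = 2 * n := by rw [vs_length, hlen]
  rcases Nat.even_or_odd' m with ⟨c, rfl | rfl⟩
  · obtain ⟨k, rfl⟩ : ∃ k, c = k + 1 := ⟨c - 1, by omega⟩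
    rw [mul_add]
    exact ⟨zeroE hs.bl hch hnd hW (by omega) (by omega), zeroPE hs.bl hch hnd hW (by omega) (by omega)⟩
  · refine ⟨?_, zeroPO hs.bl hch hnd hW (by omega) (by omega)⟩
    obtain ⟨l', p, x', rfl, q1, q2⟩ := LP_last hl (by rintro rfl; simp at hlen; omega)
    have e : vs (l' ++ [(p, x)]) = (vs l' ++ [p]) ++ [x] := by simp
    rw [e] at hch hnd hW hvl
    have hnd' := hnd
    rw [List.nodup_append] at hnd
    have hxL : x ∉ vs l' ++ [p] := fun h => hnd.2.2 x h x (by simp) rfl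
    refine zeroO2 hs.bl hch.left_of_append hnd.1
          (fun v hv => hW v (List.mem_append_left _ hv)) ?_ (by omega) (by omega) (x := x) (hW x (by simp)) hxL ?_
    · rw [List.length_append] at hvl; simp only [List.length_singleton] at hvl; omega
    · intro w hw w' hw' hne hr
      refine hno ⟨w, x', (w', x) :: l', ⟨hs.2 _ _ _ hr, q1⟩, ?_, ?_⟩
      · have n1 : (vs l').Nodup := (List.nodup_append.1 hnd.1).1
        have n2 : x ∉ vs l' := fun h => hxL (List.mem_append_left _ h)
        have hxW := hW x (by simp)
        have k1 : ∀ v ∈ W, v ∉ vs l' := fun v hv h => hW v (by simp [h]) hv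
        simp only [vs_cons, List.nodup_cons, List.mem_cons, not_or]
        exact ⟨⟨hne, fun h => hxW (h ▸ hw), k1 w hw⟩, ⟨fun h => hxW (h ▸ hw'), k1 w' hw'⟩, n2, n1⟩
      · simpa using hlen

theorem pth_of_cyc {V : Type*} {R : V → V → V → Prop} {m : ℕ} (h : Cyc R (m + 1)) : Pth R m := by
  obtain ⟨x, l, hl, hnd, hlen⟩ := h
  obtain ⟨l', p, x', rfl, q1, q2⟩ := LP_last hl (by rintro rfl; simp at hlen)
  refine ⟨x, x', l', q1, ?_, by simpa using hlen⟩
  have hp : (vs (l' ++ [(p, x)])).Perm ([p] ++ (x :: vs l')) := by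
    classical
    rw [List.perm_iff_count]; intro z
    simp [List.count_cons]; ring
  exact (List.nodup_append.1 (hp.nodup hnd)).2.1

theorem upCC {V : Type*} [DecidableEq V] [Fintype V] {R : V → V → V → Prop} (hs : SymR R) {n m : ℕ}
    (hm : 3 ≤ m) (hmn : m ≤ n) (hV : 2 * n + (m + 1) / 2 - 1 ≤ Fintype.card V) :
    Cyc R n ∨ Cyc (Bl R) m := T _ n m R hs rfl hm hmn hV

theorem upPC {V : Type*} [DecidableEq V] [Fintype V] {R : V → V → V → Prop} (hs : SymR R) {n m : ℕ}
    (hm : 3 ≤ m) (hmn : m ≤ n) (hV : 2 * n + (m + 1) / 2 ≤ Fintype.card V) :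
    Pth R n ∨ Cyc (Bl R) m := by
  rcases upCC hs hm hmn (by omega) with h | h
  · exact (path_of_cyc hs hm hmn hV h).imp id And.left
  · exact Or.inr h

theorem upPP {V : Type*} [DecidableEq V] [Fintype V] {R : V → V → V → Prop} (hs : SymR R) {n m : ℕ}
    (hm : 3 ≤ m) (hmn : m ≤ n) (hV : 2 * n + (m + 1) / 2 ≤ Fintype.card V) :
    Pth R n ∨ Pth (Bl R) m := by
  rcases Nat.lt_or_ge m n with hlt | hge
  · rcases upCC hs (n := n) (m := m + 1) (by omega) (by omega) (by omega) with h | h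
    · exact (path_of_cyc hs hm hmn hV h).imp id And.right
    · exact Or.inr (pth_of_cyc h)
  · obtain rfl : m = n := by omega
    rcases upCC hs hm hmn (by omega) with h | h
    · exact (path_of_cyc hs hm hmn hV h).imp id And.right
    · have := path_of_cyc hs.bl hm hmn hV h
      rw [bl_bl] at this
      exact (this.imp id And.right).symm

theorem LP_get {V : Type*} {R : V → V → V → Prop} {l : List (V × V)} {x z : V} (d : V)
    (h : LP R x l z) : ∀ i < l.length, R ((x :: vs l).getD (2 * i) d) ((x :: vs l).getD (2 * i + 1) d)
      ((x :: vs l).getD (2 * i + 2) d) := by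
  induction l generalizing x with
  | nil => intro i hi; simp at hi
  | cons s l ih =>
    intro i hi
    cases i with
    | zero => exact h.1
    | succ i =>
      have := ih h.2 i (by simpa using hi)
      have e : ∀ j, (x :: vs (s :: l)).getD (j + 1 + 1) d = (s.2 :: vs l).getD j d := fun j => rfl
      have e1 : 2 * (i + 1) = 2 * i + 1 + 1 := by ring
      have e2 : 2 * (i + 1) + 1 = (2 * i + 1) + 1 + 1 := by ring
      have e3 : 2 * (i + 1) + 2 = (2 * i + 2) + 1 + 1 := by ring
      rw [e3, e2, e1, e, e, e]
      exact this

theorem getD_inj {V : Type*} {L : List V} (h : L.Nodup) (d : V) :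
    Set.InjOn (fun j => L.getD j d) (Set.Iio L.length) := by
  intro a ha b hb hab
  simp only [Set.mem_Iio] at ha hb
  simp only [List.getD_eq_getElem _ _ ha, List.getD_eq_getElem _ _ hb] at hab
  exact (h.getElem_inj_iff).1 hab

def CR {V : Type*} [DecidableEq V] (col : Finset V → Bool) (b : Bool) : V → V → V → Prop :=
  fun x y z => col {x, y, z} = b

theorem CR_sym {V : Type*} [DecidableEq V] (col : Finset V → Bool) (b : Bool) : SymR (CR col b) := by
  refine ⟨fun x y z h => ?_, fun x y z h => ?_⟩
  · unfold CR at *; rw [← h]; congr 1; ext v; simp; tauto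
  · unfold CR at *; rw [← h]; congr 1; ext v; simp; tauto

theorem CR_bl {V : Type*} [DecidableEq V] (col : Finset V → Bool) : Bl (CR col true) = CR col false := by
  funext x y z; simp [Bl, CR]

theorem img3 {V : Type*} [DecidableEq V] (g : ℕ → V) :
    (Finset.range 3).image g = {g 0, g 1, g 2} := by
  ext v; simp [Finset.range_add_one]; tauto

theorem toPath {V : Type*} [DecidableEq V] {col : Finset V → Bool} {b : Bool} {n : ℕ}
    (h : Pth (CR col b) n) : HasLoosePath 3 n col b := by
  obtain ⟨x, z, l, hl, hnd, hlen⟩ := h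
  refine ⟨fun j => (x :: vs l).getD j x, ?_, ?_⟩
  · have := getD_inj hnd x
    rw [List.length_cons, vs_length, hlen] at this
    rwa [show n * (3 - 1) + 1 = 2 * n + 1 by omega]
  · intro i hi
    rw [img3]
    have := LP_get x hl i (by omega)
    unfold CR at this
    simp only [show i * (3 - 1) = 2 * i by omega, add_zero]
    exact this

theorem toCycle {V : Type*} [DecidableEq V] {col : Finset V → Bool} {b : Bool} {n : ℕ} (hn : 0 < n)
    (h : Cyc (CR col b) n) : HasLooseCycle 3 n col b := by
  obtain ⟨x, l, hl, hnd, hlen⟩ := h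
  obtain ⟨l', p, x', e, q1, q2⟩ := LP_last hl (by rintro rfl; simp at hlen; omega)
  have e1 : x :: vs l = (x :: (vs l' ++ [p])) ++ [x] := by simp [e]
  have hnd' : (x :: (vs l' ++ [p])).Nodup := by
    have hp : (vs l).Perm (x :: (vs l' ++ [p])) := by
      rw [e, List.perm_iff_count]; intro z
      simp [List.count_cons]; ring
    exact hp.nodup hnd
  have hL : (x :: (vs l' ++ [p])).length = 2 * n := by
    have : l'.length + 1 = n := by rw [← hlen, e]; simp
    simp [vs_length]; omega
  have key : ∀ t ≤ 2 * n, (x :: vs l).getD t x = (x :: (vs l' ++ [p])).getD (t % (2 * n)) x := by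
    intro t ht
    rw [e1]
    rcases Nat.lt_or_ge t (2 * n) with h | h
    · rw [Nat.mod_eq_of_lt h, List.getD_append _ _ _ _ (by omega)]
    · obtain rfl : t = 2 * n := by omega
      rw [Nat.mod_self, List.getD_append_right _ _ _ _ (by omega), hL]
      simp
  have e2 : n * (3 - 1) = 2 * n := by omega
  refine ⟨fun j => (x :: (vs l' ++ [p])).getD j x, ?_, ?_⟩
  · have := getD_inj hnd' x
    rw [hL] at this
    rwa [e2]
  · intro i hi
    rw [img3]
    have := LP_get x hl i (by omega)
    unfold CR at this
    rw [key _ (by omega), key _ (by omega), key _ (by omega)] at this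
    simp only [show i * (3 - 1) = 2 * i by omega, e2, add_zero]
    exact this

theorem count_red {N s K : ℕ} {f : ℕ → Fin N} (hf : Set.InjOn f (Set.Iio K))
    (h : ∀ j < K, (f j).val < s) : K ≤ s := by
  have := Finset.card_le_card_of_injOn (s := Finset.range K) (t := Finset.range s) (fun j => (f j).val)
    (by intro j hj; simp at hj ⊢; exact h j hj)
    (by intro a ha b hb hab
        exact hf (by simpa using ha) (by simpa using hb) (Fin.ext hab))
  simpa using this

theorem count_blue {N s K m : ℕ} {f : ℕ → Fin N} (hf : Set.InjOn f (Set.Iio K)) (P : ℕ → ℕ → Prop)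
    (h : ∀ i < m, ∃ t < K, P i t ∧ s ≤ (f t).val)
    (hP : ∀ t, ∃ a b, ∀ i < m, P i t → i = a ∨ i = b) : m ≤ 2 * (N - s) := by
  choose! t h1 h2 h3 using h
  have hc := Finset.card_le_mul_card_image (f := fun i => (f (t i)).val) (Finset.range m) 2 (by
    intro v hv
    simp only [Finset.mem_image, Finset.mem_range] at hv
    obtain ⟨i0, hi0, rfl⟩ := hv
    obtain ⟨a, b, hab⟩ := hP (t i0)
    refine (Finset.card_le_card (t := {a, b}) ?_).trans Finset.card_le_two
    intro i hi
    simp only [Finset.mem_filter, Finset.mem_range] at hi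
    have : t i = t i0 := hf (h1 i hi.1) (h1 i0 hi0) (Fin.ext hi.2)
    have := hab i hi.1 (this ▸ h2 i hi.1)
    simpa using this)
  have hi : (Finset.range m).image (fun i => (f (t i)).val) ⊆ Finset.Ico s N := by
    intro v hv
    simp only [Finset.mem_image, Finset.mem_range] at hv
    obtain ⟨i0, hi0, rfl⟩ := hv
    simp only [Finset.mem_Ico]
    exact ⟨h3 i0 hi0, (f (t i0)).isLt⟩
  have := Finset.card_le_card hi
  simp at this hc
  omega

def lc (N s : ℕ) : Finset (Fin N) → Bool := fun S => decide (∀ v ∈ S, v.val < s)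

theorem red_path {N s n : ℕ} (hn : 0 < n) (h : HasLoosePath 3 n (lc N s) true) : 2 * n + 1 ≤ s := by
  obtain ⟨f, hf, hc⟩ := h
  rw [show n * (3 - 1) + 1 = 2 * n + 1 by omega] at hf
  refine count_red hf ?_
  have hc' : ∀ i < n, ∀ j < 3, (f (i * 2 + j)).val < s := by
    intro i hi j hj
    have := hc i hi
    simp only [lc, decide_eq_true_eq, Finset.mem_image, Finset.mem_range] at this
    exact this _ ⟨j, hj, rfl⟩
  intro j hj
  rcases Nat.lt_or_ge j (2 * n) with h | h
  · have := hc' (j / 2) (by omega) (j % 2) (by omega)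
    rwa [show j / 2 * 2 + j % 2 = j by omega] at this
  · have := hc' (n - 1) (by omega) 2 (by omega)
    rwa [show (n - 1) * 2 + 2 = j by omega] at this

theorem red_cycle {N s n : ℕ} (h : HasLooseCycle 3 n (lc N s) true) : 2 * n ≤ s := by
  obtain ⟨f, hf, hc⟩ := h
  rw [show n * (3 - 1) = 2 * n by omega] at hf
  refine count_red hf ?_
  intro j hj
  have := hc (j / 2) (by omega)
  simp only [lc, decide_eq_true_eq, Finset.mem_image, Finset.mem_range] at this
  refine this _ ⟨j % 2, by omega, ?_⟩
  congr 1
  rw [show j / 2 * (3 - 1) + j % 2 = j by omega, Nat.mod_eq_of_lt (by omega)]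

theorem blue_path {N s m : ℕ} (h : HasLoosePath 3 m (lc N s) false) : m ≤ 2 * (N - s) := by
  obtain ⟨f, hf, hc⟩ := h
  refine count_blue hf (fun i t => t = i * 2 ∨ t = i * 2 + 1 ∨ t = i * 2 + 2) ?_ ?_
  · intro i hi
    have := hc i hi
    simp only [lc, decide_eq_false_iff_not, Finset.mem_image, Finset.mem_range] at this
    push Not at this
    obtain ⟨_, ⟨j, hj, rfl⟩, hv⟩ := this
    exact ⟨_, by omega, by omega, hv⟩
  · intro t
    exact ⟨t / 2, t / 2 - 1, fun i hi hP => by omega⟩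

theorem blue_cycle {N s m : ℕ} (hm : 0 < m) (h : HasLooseCycle 3 m (lc N s) false) : m ≤ 2 * (N - s) := by
  obtain ⟨f, hf, hc⟩ := h
  refine count_blue hf (fun i t => t = i * 2 ∨ t = i * 2 + 1 ∨ (t = i * 2 + 2 ∧ i + 1 < m) ∨ (t = 0 ∧ i + 1 = m)) ?_ ?_
  · intro i hi
    have := hc i hi
    simp only [lc, decide_eq_false_iff_not, Finset.mem_image, Finset.mem_range] at this
    push Not at this
    obtain ⟨_, ⟨j, hj, rfl⟩, hv⟩ := this
    refine ⟨_, Nat.mod_lt _ (by omega), ?_, hv⟩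
    rcases Nat.lt_or_ge (i * (3 - 1) + j) (m * (3 - 1)) with h | h
    · rw [Nat.mod_eq_of_lt h]; omega
    · have e : i * (3 - 1) + j = m * (3 - 1) := by omega
      rw [e, Nat.mod_self]; omega
  · intro t
    by_cases ht : t = 0
    · exact ⟨0, m - 1, fun i hi hP => by omega⟩
    · exact ⟨t / 2, t / 2 - 1, fun i hi hP => by omega⟩

end LR

/-- For all integers n ≥ m ≥ 3,
R(P³ₙ, P³ₘ) = R(P³ₙ, C³ₘ) = R(C³ₙ, C³ₘ) + 1 = 2n + ⌊(m+1)/2⌋. -/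
theorem ramsey_three_uniform_paths_cycles (n m : ℕ) (hm : 3 ≤ m) (hnm : m ≤ n) :
    RamseyPP 3 n m = 2 * n + (m + 1) / 2 ∧
    RamseyPC 3 n m = 2 * n + (m + 1) / 2 ∧
    RamseyCC 3 n m + 1 = 2 * n + (m + 1) / 2 := by
  have hCC : RamseyCC 3 n m = 2 * n + (m + 1) / 2 - 1 := by
    refine IsLeast.csInf_eq ⟨⟨by omega, fun col => ?_⟩, ?_⟩
    · have := LR.upCC (LR.CR_sym col true) hm hnm (by simp)
      rw [LR.CR_bl] at this
      exact this.imp (LR.toCycle (by omega)) (LR.toCycle (by omega))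
    · rintro N ⟨-, h⟩
      rcases h (LR.lc N (2 * n - 1)) with h | h
      · have := LR.red_cycle h; omega
      · have := LR.blue_cycle (by omega) h; omega
  refine ⟨?_, ?_, by omega⟩
  · refine IsLeast.csInf_eq ⟨⟨by omega, fun col => ?_⟩, ?_⟩
    · have := LR.upPP (LR.CR_sym col true) hm hnm (by simp)
      rw [LR.CR_bl] at this
      exact this.imp LR.toPath LR.toPath
    · rintro N ⟨-, h⟩
      rcases h (LR.lc N (2 * n)) with h | h
      · have := LR.red_path (by omega) h; omega
      · have := LR.blue_path h; omega
  · refine IsLeast.csInf_eq ⟨⟨by omega, fun col => ?_⟩, ?_⟩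
    · have := LR.upPC (LR.CR_sym col true) hm hnm (by simp)
      rw [LR.CR_bl] at this
      exact this.imp LR.toPath (LR.toCycle (by omega))
    · rintro N ⟨-, h⟩
      rcases h (LR.lc N (2 * n)) with h | h
      · have := LR.red_path (by omega) h; omega
      · have := LR.blue_cycle (by omega) h; omega
end

section
/- Let k ≥ 3 and n ≥ m ≥ 2 be integers, and suppose that R(C^k_n, C^k_m) = (k−1)n + ⌊(m−1)/2⌋. Then R(P^k_n, C^k_m) = (k−1)n + ⌊(m+1)/2⌋ and R(P^k_n, P^k_{m−1}) = (k−1)n + ⌊m/2⌋. Moreover, if n = m then R(P^k_n, P^k_m) = (k−1)n + ⌊(m+1)/2⌋. -/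
theorem lp_decomp {K : ℕ} (hK : 0 < K) (i j : ℕ) (hj : j < K) :
    (i * K + j) / K = i ∧ (i * K + j) % K = j := by
  constructor
  · rw [Nat.add_comm, Nat.add_mul_div_right _ _ hK, Nat.div_eq_of_lt hj, Nat.zero_add]
  · rw [Nat.add_comm, Nat.add_mul_mod_self_right, Nat.mod_eq_of_lt hj]

theorem lp_decomp_inj {K : ℕ} (hK : 0 < K) {i j i' j' : ℕ} (hj : j < K) (hj' : j' < K)
    (h : i * K + j = i' * K + j') : i = i' ∧ j = j' := by
  have h1 := lp_decomp hK i j hj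
  have h2 := lp_decomp hK i' j' hj'
  rw [h] at h1
  exact ⟨h1.1.symm.trans h2.1, h1.2.symm.trans h2.2⟩

theorem lp_lt {K n i j : ℕ} (hi : i < n) (hj : j < K) : i * K + j < n * K := by
  have : (i + 1) * K ≤ n * K := Nat.mul_le_mul_right K hi
  rw [Nat.add_mul] at this
  omega

/-- enumeration of a finset -/
theorem lp_enum {V : Type*} [DecidableEq V] [Inhabited V] (T : Finset V) :
    ∃ t : ℕ → V, Set.InjOn t (Set.Iio T.card) ∧ (∀ i < T.card, t i ∈ T) ∧
      (Finset.range T.card).image t = T := by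
  let e := T.equivFin
  have key : ∀ i (h : i < T.card),
      (fun i => if h : i < T.card then ((e.symm ⟨i, h⟩ : T) : V) else default) i
        = ((e.symm ⟨i, h⟩ : T) : V) := fun i h => dif_pos h
  refine ⟨fun i => if h : i < T.card then ((e.symm ⟨i, h⟩ : T) : V) else default, ?_, ?_, ?_⟩
  · intro a ha b hb hab
    rw [key a ha, key b hb] at hab
    have := e.symm.injective (Subtype.ext hab)
    exact congrArg Fin.val this
  · intro i hi
    rw [key i hi]
    exact (e.symm ⟨i, hi⟩).2
  · ext x
    simp only [Finset.mem_image, Finset.mem_range]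
    constructor
    · rintro ⟨i, hi, rfl⟩
      rw [dif_pos hi]
      exact (e.symm ⟨i, hi⟩).2
    · intro hx
      refine ⟨(e ⟨x, hx⟩).1, (e ⟨x, hx⟩).2, ?_⟩
      rw [dif_pos (e ⟨x, hx⟩).2]
      simp

theorem lp_extend_end {V : Type*} [DecidableEq V] (K n : ℕ) (hK : 0 < K)
    (col : Finset V → Bool) (b : Bool) (f : ℕ → V)
    (hf : Set.InjOn f (Set.Iio (n * K + 1)))
    (he : ∀ i < n, col ((Finset.range (K + 1)).image fun j => f (i * K + j)) = b)
    (T : Finset V) (hT : T.card = K) (hd : ∀ p ≤ n * K, f p ∉ T)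
    (hc : col (insert (f (n * K)) T) = b) : HasLoosePath (K + 1) (n + 1) col b := by
  have : Inhabited V := ⟨f 0⟩
  obtain ⟨t, ht1, ht2, ht3⟩ := lp_enum T
  rw [hT] at ht1 ht2 ht3
  have hn1 : (n + 1) * K = n * K + K := by ring
  refine ⟨fun p => if p ≤ n * K then f p else t (p - n * K - 1), ?_, ?_⟩
  · intro p hp q hq hpq
    simp only [Set.mem_Iio, Nat.add_sub_cancel, hn1] at hp hq
    dsimp only at hpq
    split_ifs at hpq with h1 h2 h2
    · exact hf (by simp; omega) (by simp; omega) hpq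
    · exact absurd (hpq ▸ ht2 _ (by omega)) (hd p h1)
    · exact absurd (hpq ▸ ht2 _ (by omega)) (hd q h2)
    · have := ht1 (by simp; omega) (by simp; omega) hpq
      omega
  · intro i hi
    simp only [Nat.add_sub_cancel]
    rcases Nat.lt_or_ge i n with h | h
    · rw [← he i h]
      congr 1
      apply Finset.image_congr
      intro j hj
      simp only [Finset.coe_range, Set.mem_Iio] at hj
      have : (i + 1) * K ≤ n * K := Nat.mul_le_mul_right K h
      rw [Nat.add_mul] at this
      exact if_pos (by omega)
    · have : i = n := by omega
      subst this
      rw [← hc]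
      congr 1
      rw [Finset.range_add_one', Finset.image_insert, Finset.map_eq_image, Finset.image_image]
      congr 1
      · simp
      · rw [← ht3]
        apply Finset.image_congr
        intro j _
        change (if i * K + (j + 1) ≤ i * K then f (i * K + (j + 1))
          else t (i * K + (j + 1) - i * K - 1)) = t j
        rw [if_neg (by omega)]
        congr 1
        omega

theorem lp_extend_start {V : Type*} [DecidableEq V] (K n : ℕ) (hK : 0 < K)
    (col : Finset V → Bool) (b : Bool) (f : ℕ → V)
    (hf : Set.InjOn f (Set.Iio (n * K + 1)))
    (he : ∀ i < n, col ((Finset.range (K + 1)).image fun j => f (i * K + j)) = b)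
    (T : Finset V) (hT : T.card = K) (hd : ∀ p ≤ n * K, f p ∉ T)
    (hc : col (insert (f 0) T) = b) : HasLoosePath (K + 1) (n + 1) col b := by
  have : Inhabited V := ⟨f 0⟩
  obtain ⟨t, ht1, ht2, ht3⟩ := lp_enum T
  rw [hT] at ht1 ht2 ht3
  have hn1 : (n + 1) * K = n * K + K := by ring
  refine ⟨fun p => if p < K then t p else f (p - K), ?_, ?_⟩
  · intro p hp q hq hpq
    simp only [Set.mem_Iio, Nat.add_sub_cancel, hn1] at hp hq
    dsimp only at hpq
    split_ifs at hpq with h1 h2 h2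
    · exact ht1 h1 h2 hpq
    · exact absurd (hpq ▸ ht2 _ h1) (hd (q - K) (by omega))
    · exact absurd (hpq ▸ ht2 _ h2) (hd (p - K) (by omega))
    · have := hf (by simp; omega) (by simp; omega) hpq
      omega
  · intro i hi
    simp only [Nat.add_sub_cancel]
    rcases Nat.eq_zero_or_pos i with h | h
    · subst h
      rw [← hc]
      congr 1
      rw [Finset.range_add_one, Finset.image_insert]
      congr 1
      · simp
      · refine Eq.trans ?_ ht3
        apply Finset.image_congr
        intro j hj
        simp only [Finset.coe_range, Set.mem_Iio] at hj
        simp [hj]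
    · obtain ⟨i, rfl⟩ : ∃ i', i = i' + 1 := ⟨i - 1, by omega⟩
      rw [← he i (by omega)]
      congr 1
      apply Finset.image_congr
      intro j _
      have : (i + 1) * K = i * K + K := by ring
      dsimp only
      rw [if_neg (by omega)]
      congr 1
      omega

theorem lp_forced {V : Type*} [DecidableEq V] (K n : ℕ) (hK : 0 < K) (hn : 2 ≤ n)
    (col : Finset V → Bool) (b : Bool) (f : ℕ → V)
    (hf : Set.InjOn f (Set.Iio (n * K)))
    (he : ∀ i < n, col ((Finset.range (K + 1)).image fun j => f ((i * K + j) % (n * K))) = b)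
    (hno : ¬ HasLoosePath (K + 1) n col b)
    (i : ℕ) (hi : i < n) (e : ℕ → V) (hinj : Set.InjOn e (Set.Iio (K + 1)))
    (x0 : ℕ) (hx0 : x0 ≤ K)
    (hu : e x0 = f (i * K) ∨ e x0 = f (((i + 1) * K) % (n * K)))
    (hx : ∀ x ≤ K, x ≠ x0 → (∃ r, 0 < r ∧ r < K ∧ e x = f (i * K + r)) ∨
      ∀ p < n * K, e x ≠ f p) :
    col ((Finset.range (K + 1)).image e) = !b := by
  by_contra hcon
  have hcol : col ((Finset.range (K + 1)).image e) = b := by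
    cases b <;> simp_all
  apply hno
  have hnK : 0 < n * K := Nat.mul_pos (by omega) hK
  obtain ⟨n', rfl⟩ : ∃ n', n = n' + 1 := ⟨n - 1, by omega⟩
  have hnK' : (n' + 1) * K = n' * K + K := by ring
  have hee : ∀ j, col ((Finset.range (K + 1)).image
      fun x => f ((j * K + x) % ((n' + 1) * K))) = b := by
    intro j
    rw [← he (j % (n' + 1)) (Nat.mod_lt _ (by omega))]
    congr 1
    apply Finset.image_congr
    intro x _
    dsimp only
    congr 1
    conv_lhs => rw [Nat.add_mod]
    conv_rhs => rw [Nat.add_mod]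
    rw [Nat.mul_mod_mul_right, Nat.mul_mod_mul_right, Nat.mod_mod]
  set F : ℕ → V := fun p => f ((p + (i + 1) * K) % ((n' + 1) * K)) with hF
  have hFinj : Set.InjOn F (Set.Iio (n' * K + 1)) := by
    intro p hp q hq hpq
    simp only [Set.mem_Iio] at hp hq
    have h1 := hf (Nat.mod_lt _ hnK) (Nat.mod_lt _ hnK) hpq
    have h2 : p ≡ q [MOD ((n' + 1) * K)] := Nat.ModEq.add_right_cancel' _ h1
    exact Nat.ModEq.eq_of_lt_of_lt h2 (by omega) (by omega)
  have hFe : ∀ j < n', col ((Finset.range (K + 1)).image fun x => F (j * K + x)) = b := by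
    intro j _
    rw [← hee (j + (i + 1))]
    congr 1
    apply Finset.image_congr
    intro x _
    simp only [hF]
    congr 2
    ring
  have hF0 : F 0 = f (((i + 1) * K) % ((n' + 1) * K)) := by simp [hF]
  have hiK : i * K < (n' + 1) * K := Nat.mul_lt_mul_of_pos_right hi hK
  have hF1 : F (n' * K) = f (i * K) := by
    simp only [hF]
    congr 1
    have : n' * K + (i + 1) * K = i * K + (n' + 1) * K := by ring
    rw [this, Nat.add_mod_right, Nat.mod_eq_of_lt hiK]
  set T := ((Finset.range (K + 1)).erase x0).image e with hTdef
  have hx0m : x0 ∈ Finset.range (K + 1) := by simp; omega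
  have hT : T.card = K := by
    rw [hTdef, Finset.card_image_of_injOn, Finset.card_erase_of_mem hx0m]
    · simp
    · apply hinj.mono
      intro y hy
      simp at hy ⊢
      omega
  have hIns : insert (e x0) T = (Finset.range (K + 1)).image e := by
    rw [hTdef, ← Finset.image_insert, Finset.insert_erase hx0m]
  have hd : ∀ p ≤ n' * K, F p ∉ T := by
    intro p hp hmem
    simp only [hTdef, Finset.mem_image, Finset.mem_erase, Finset.mem_range] at hmem
    obtain ⟨x, ⟨hxne, hxK⟩, hxe⟩ := hmem
    rcases hx x (by omega) hxne with ⟨r, hr0, hrK, hr⟩ | h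
    · rw [hr] at hxe
      have h0 := lp_lt hi hrK
      have h1 := hf h0 (Nat.mod_lt _ hnK) hxe
      have h2 : i * K + r ≡ i * K + (p + K) [MOD ((n' + 1) * K)] := by
        have h3 : i * K + (p + K) = p + (i + 1) * K := by ring
        rw [h3]
        unfold Nat.ModEq
        rw [← h1, Nat.mod_eq_of_lt h0]
      have h4 : r ≡ p + K [MOD ((n' + 1) * K)] := Nat.ModEq.add_left_cancel' _ h2
      unfold Nat.ModEq at h4
      rw [Nat.mod_eq_of_lt (by omega : r < (n' + 1) * K)] at h4
      rcases Nat.lt_or_ge (p + K) ((n' + 1) * K) with h5 | h5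
      · rw [Nat.mod_eq_of_lt h5] at h4
        omega
      · have : p + K = (n' + 1) * K := by omega
        rw [this, Nat.mod_self] at h4
        omega
    · exact h _ (Nat.mod_lt _ hnK) hxe
  rcases hu with hu | hu
  · exact lp_extend_end K n' hK col b F hFinj hFe T hT hd (by rw [hF1, ← hu, hIns, hcol])
  · exact lp_extend_start K n' hK col b F hFinj hFe T hT hd (by rw [hF0, ← hu, hIns, hcol])

/-- vertices outside a cycle -/
theorem lp_outside {V : Type*} [DecidableEq V] [Fintype V] (M s : ℕ) (f : ℕ → V)
    (hf : Set.InjOn f (Set.Iio M)) (hcard : M + s ≤ Fintype.card V) :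
    ∃ w : ℕ → V, Set.InjOn w (Set.Iio s) ∧ ∀ i < s, ∀ p < M, w i ≠ f p := by
  have : Inhabited V := ⟨f 0⟩
  set T := Finset.univ \ (Finset.range M).image f with hT
  have h1 : T.card = Fintype.card V - M := by
    rw [hT, Finset.card_sdiff_of_subset (Finset.subset_univ _), Finset.card_univ,
      Finset.card_image_of_injOn (by simpa using hf), Finset.card_range]
  obtain ⟨t, ht1, ht2, _⟩ := lp_enum T
  refine ⟨t, ht1.mono (fun x hx => ?_), ?_⟩
  · simp only [Set.mem_Iio] at hx ⊢
    omega
  · intro i hi p hp heq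
    have := ht2 i (by omega)
    rw [heq, hT] at this
    simp only [Finset.mem_sdiff, Finset.mem_image, Finset.mem_range] at this
    exact this.2 ⟨p, hp, rfl⟩

theorem lp_main_path {V : Type*} [DecidableEq V] [Fintype V] (K n L : ℕ) (hK : 0 < K)
    (hn : 2 ≤ n) (hL : L ≤ n) (col : Finset V → Bool) (b : Bool)
    (hcard : n * K + (L + 1) / 2 ≤ Fintype.card V)
    (hcyc : HasLooseCycle (K + 1) n col b) :
    HasLoosePath (K + 1) n col b ∨ HasLoosePath (K + 1) L col (!b) := by
  by_cases hno : HasLoosePath (K + 1) n col b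
  · exact Or.inl hno
  right
  obtain ⟨f, hf, he⟩ := hcyc
  simp only [Nat.add_sub_cancel] at hf he
  obtain ⟨w, hw, hwf⟩ := lp_outside _ _ f hf hcard
  have hG : ∀ a j a' j', a < n → j < K → a' < n → j' < K → f (a * K + j) = f (a' * K + j') →
      a = a' ∧ j = j' := by
    intro a j a' j' ha hj ha' hj' h
    exact lp_decomp_inj hK hj hj' (hf (lp_lt ha hj) (lp_lt ha' hj') h)
  set c : ℕ → ℕ := fun i => if i = 0 then 1 else if i = n then 0 else i with hc
  set g : ℕ → ℕ → V := fun i j =>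
    if j = 0 then (if i % 2 = 1 then w (i / 2) else f (c i * K + 0)) else f (i * K + j) with hg
  have hginj : ∀ i j i' j', i ≤ L → j < K → (i = L → j = 0) → i' ≤ L → j' < K →
      (i' = L → j' = 0) → g i j = g i' j' → i = i' ∧ j = j' := by
    intro i j i' j' hi hj hij hi' hj' hij' h
    have hcn : ∀ x ≤ L, c x < n := by
      intro x hx
      simp only [hc]
      split_ifs <;> omega
    simp only [hg] at h
    split_ifs at h with h1 h2 h3 h4 h5 h6 h7 h8 h9
    · have := hw (by simp; omega) (by simp; omega) h
      omega
    · exact absurd h (hwf _ (by omega) _ (lp_lt (hcn _ hi') hK))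
    · exact absurd h (hwf _ (by omega) _ (lp_lt (by omega) hj'))
    · exact absurd h.symm (hwf _ (by omega) _ (lp_lt (hcn _ hi) hK))
    · have := (hG _ _ _ _ (hcn _ hi) hK (hcn _ hi') hK h).1
      simp only [hc] at this
      split_ifs at this <;> omega
    · have := (hG _ _ _ _ (hcn _ hi) hK (by omega) hj' h).2
      omega
    · exact absurd h.symm (hwf _ (by omega) _ (lp_lt (by omega) hj))
    · have := (hG _ _ _ _ (by omega) hj (hcn _ hi') hK h).2
      omega
    · exact hG _ _ _ _ (by omega) hj (by omega) hj' h
  have hdiv : ∀ p < L * K + 1, p / K ≤ L ∧ p % K < K ∧ (p / K = L → p % K = 0) := by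
    intro p hp
    have h1 := Nat.div_add_mod p K
    have h2 := Nat.mod_lt p hK
    have h3 : p / K ≤ L := by
      by_contra hcon
      have : (L + 1) * K ≤ (p / K) * K := Nat.mul_le_mul_right K (by omega)
      rw [Nat.add_mul, Nat.mul_comm (p / K)] at this
      omega
    refine ⟨h3, h2, fun h4 => ?_⟩
    rw [h4, Nat.mul_comm] at h1
    omega
  have hinj : Set.InjOn (fun p => g (p / K) (p % K)) (Set.Iio (L * K + 1)) := by
    intro p hp q hq hpq
    obtain ⟨a1, a2, a3⟩ := hdiv p hp
    obtain ⟨b1, b2, b3⟩ := hdiv q hq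
    obtain ⟨h1, h2⟩ := hginj _ _ _ _ a1 a2 a3 b1 b2 b3 hpq
    rw [← Nat.div_add_mod p K, ← Nat.div_add_mod q K, h1, h2]
  refine ⟨fun p => g (p / K) (p % K), by simpa using hinj, ?_⟩
  intro i hi
  simp only [Nat.add_sub_cancel]
  have hiL : (i + 1) * K ≤ L * K := Nat.mul_le_mul_right K hi
  have hi1 : (i + 1) * K = i * K + K := by ring
  set e : ℕ → V := fun j => g ((i * K + j) / K) ((i * K + j) % K) with hedef
  have ex : ∀ x < K, e x = g i x := by
    intro x hx
    obtain ⟨h1, h2⟩ := lp_decomp hK i x hx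
    simp only [hedef]
    rw [h1, h2]
  have exK : e K = g (i + 1) 0 := by
    simp only [hedef]
    rw [← hi1, Nat.mul_div_cancel _ hK, Nat.mul_mod_left]
  have einj : Set.InjOn e (Set.Iio (K + 1)) := by
    intro p hp q hq hpq
    simp only [Set.mem_Iio] at hp hq
    have := hinj (by simp; omega : i * K + p ∈ _) (by simp; omega : i * K + q ∈ _) hpq
    omega
  have hint : ∀ x, 0 < x → x < K → (∃ r, 0 < r ∧ r < K ∧
      e x = f (i * K + r)) := by
    intro x hx hxK
    refine ⟨x, hx, hxK, ?_⟩
    rw [ex x hxK]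
    simp only [hg]
    rw [if_neg (by omega)]
  rcases Nat.mod_two_eq_zero_or_one i with hpar | hpar
  · refine lp_forced K n hK hn col b f hf he hno i (by omega) _ einj 0 (by omega) ?_ ?_
    · rw [ex 0 hK]
      simp only [hg, hc]
      rw [if_pos trivial, if_neg (by omega)]
      by_cases hi0 : i = 0
      · right
        subst hi0
        simp only [if_true]
        congr 1
        rw [Nat.mod_eq_of_lt]
        · ring
        · exact Nat.mul_lt_mul_of_pos_right (by omega) hK
      · left
        rw [if_neg hi0, if_neg (by omega)]
        rfl
    · intro x hx hx0
      rcases Nat.lt_or_ge x K with h | h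
      · exact Or.inl (hint x (by omega) h)
      · right
        have : x = K := by omega
        rw [this, exK]
        simp only [hg]
        rw [if_pos trivial, if_pos (by omega)]
        exact hwf _ (by omega)
  · refine lp_forced K n hK hn col b f hf he hno i (by omega) _ einj K (by omega) ?_ ?_
    · right
      rw [exK]
      simp only [hg, hc]
      rw [if_pos trivial, if_neg (by omega), if_neg (by omega)]
      congr 1
      by_cases hin : i + 1 = n
      · rw [if_pos hin, hin, Nat.mod_self]
        ring
      · rw [if_neg hin, Nat.mod_eq_of_lt]
        · rfl
        · exact Nat.mul_lt_mul_of_pos_right (by omega) hK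
    · intro x hx hx0
      rcases Nat.eq_zero_or_pos x with h | h
      · right
        subst h
        rw [ex 0 hK]
        simp only [hg]
        rw [if_pos trivial, if_pos (by omega)]
        exact hwf _ (by omega)
      · exact Or.inl (hint x h (by omega))

theorem lp_main_cycle {V : Type*} [DecidableEq V] [Fintype V] (K n m : ℕ) (hK : 2 ≤ K)
    (hm : 2 ≤ m) (hmn : m ≤ n) (col : Finset V → Bool) (b : Bool)
    (hcard : n * K + (m + 1) / 2 ≤ Fintype.card V)
    (hcyc : HasLooseCycle (K + 1) n col b) :
    HasLoosePath (K + 1) n col b ∨ HasLooseCycle (K + 1) m col (!b) := by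
  by_cases hno : HasLoosePath (K + 1) n col b
  · exact Or.inl hno
  right
  have hK0 : 0 < K := by omega
  obtain ⟨f, hf, he⟩ := hcyc
  simp only [Nat.add_sub_cancel] at hf he
  obtain ⟨w, hw, hwf⟩ := lp_outside _ _ f hf hcard
  have hG : ∀ a j a' j', a < n → j < K → a' < n → j' < K → f (a * K + j) = f (a' * K + j') →
      a = a' ∧ j = j' := by
    intro a j a' j' ha hj ha' hj' h
    exact lp_decomp_inj hK0 hj hj' (hf (lp_lt ha hj) (lp_lt ha' hj') h)
  set c : ℕ → ℕ → ℕ := fun i j => if i % 2 = 0 ∧ i = m - 1 ∧ j = 1 then 0 else j with hc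
  set g : ℕ → ℕ → V := fun i j =>
    if j = 0 ∧ i % 2 = 0 then w (i / 2) else f (i * K + c i j) with hg
  have hcK : ∀ i j, j < K → c i j < K := by
    intro i j hj
    simp only [hc]
    split_ifs <;> omega
  have hginj : ∀ i j i' j', i < m → j < K → i' < m → j' < K →
      g i j = g i' j' → i = i' ∧ j = j' := by
    intro i j i' j' hi hj hi' hj' h
    simp only [hg] at h
    split_ifs at h with h1 h2 h3
    · have := hw (by simp; omega) (by simp; omega) h
      omega
    · exact absurd h (hwf _ (by omega) _ (lp_lt (by omega) (hcK _ _ hj')))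
    · exact absurd h.symm (hwf _ (by omega) _ (lp_lt (by omega) (hcK _ _ hj)))
    · obtain ⟨r1, r2⟩ := hG _ _ _ _ (by omega) (hcK _ _ hj) (by omega) (hcK _ _ hj') h
      refine ⟨r1, ?_⟩
      simp only [hc] at r2
      split_ifs at r2 <;> omega
  have hinj : Set.InjOn (fun p => g (p / K) (p % K)) (Set.Iio (m * K)) := by
    intro p hp q hq hpq
    obtain ⟨h1, h2⟩ := hginj _ _ _ _ (Nat.div_lt_of_lt_mul (by rw [Nat.mul_comm]; exact hp))
      (Nat.mod_lt _ hK0) (Nat.div_lt_of_lt_mul (by rw [Nat.mul_comm]; exact hq))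
      (Nat.mod_lt _ hK0) hpq
    rw [← Nat.div_add_mod p K, ← Nat.div_add_mod q K, h1, h2]
  refine ⟨fun p => g (p / K) (p % K), by simpa using hinj, ?_⟩
  intro i hi
  simp only [Nat.add_sub_cancel]
  have hiL : (i + 1) * K ≤ m * K := Nat.mul_le_mul_right K hi
  have hi1 : (i + 1) * K = i * K + K := by ring
  have h2m : 2 * K ≤ m * K := Nat.mul_le_mul_right K hm
  have hmK : 0 < m * K := by omega
  set e : ℕ → V := fun j => g ((i * K + j) % (m * K) / K) ((i * K + j) % (m * K) % K) with hedef
  have ex : ∀ x < K, e x = g i x := by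
    intro x hx
    obtain ⟨h1, h2⟩ := lp_decomp hK0 i x hx
    simp only [hedef]
    rw [Nat.mod_eq_of_lt (lp_lt hi hx), h1, h2]
  have exK : e K = g (if i + 1 < m then i + 1 else 0) 0 := by
    simp only [hedef]
    rw [← hi1]
    split_ifs with h
    · rw [Nat.mod_eq_of_lt (Nat.mul_lt_mul_of_pos_right h hK0), Nat.mul_div_cancel _ hK0,
        Nat.mul_mod_left]
    · have : i + 1 = m := by omega
      rw [this, Nat.mod_self]
      simp
  have einj : Set.InjOn e (Set.Iio (K + 1)) := by
    intro p hp q hq hpq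
    simp only [Set.mem_Iio] at hp hq
    have h1 := hinj (Nat.mod_lt _ hmK) (Nat.mod_lt _ hmK) hpq
    have h2 : p ≡ q [MOD (m * K)] := Nat.ModEq.add_left_cancel' (i * K) h1
    exact Nat.ModEq.eq_of_lt_of_lt h2 (by omega) (by omega)
  have hint : ∀ x, 0 < x → x < K → ¬ (i % 2 = 0 ∧ i = m - 1 ∧ x = 1) →
      (∃ r, 0 < r ∧ r < K ∧ e x = f (i * K + r)) := by
    intro x hx hxK hne
    refine ⟨x, hx, hxK, ?_⟩
    rw [ex x hxK]
    simp only [hg, hc]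
    rw [if_neg (by omega), if_neg hne]
  have hww : ∀ a, a < m → a % 2 = 0 → ∀ p < n * K, g a 0 ≠ f p := by
    intro a ha ha2
    simp only [hg]
    rw [if_pos ⟨trivial, ha2⟩]
    exact hwf _ (by omega)
  rcases Nat.mod_two_eq_zero_or_one i with hpar | hpar
  · by_cases hlast : i + 1 < m
    · refine lp_forced K n hK0 (by omega) col b f hf he hno i (by omega) _ einj K (by omega) ?_ ?_
      · right
        rw [exK, if_pos hlast]
        simp only [hg, hc]
        rw [if_neg (by omega), Nat.mod_eq_of_lt (Nat.mul_lt_mul_of_pos_right (by omega) hK0)]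
        simp
      · intro x hx hx0
        rcases Nat.eq_zero_or_pos x with h | h
        · right
          subst h
          rw [ex 0 hK0]
          exact hww i hi hpar
        · exact Or.inl (hint x h (by omega) (by omega))
    · refine lp_forced K n hK0 (by omega) col b f hf he hno i (by omega) _ einj 1 (by omega) ?_ ?_
      · left
        rw [ex 1 (by omega)]
        have h1 : c i 1 = 0 := if_pos ⟨hpar, by omega, rfl⟩
        have h2 : g i 1 = f (i * K + c i 1) := if_neg (by omega)
        rw [h2, h1]
        rfl
      · intro x hx hx0
        rcases Nat.eq_zero_or_pos x with h | h
        · right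
          subst h
          rw [ex 0 hK0]
          exact hww i hi hpar
        · rcases Nat.lt_or_ge x K with h' | h'
          · exact Or.inl (hint x h h' (by omega))
          · right
            have : x = K := by omega
            rw [this, exK, if_neg hlast]
            exact hww 0 (by omega) rfl
  · refine lp_forced K n hK0 (by omega) col b f hf he hno i (by omega) _ einj 0 (by omega) ?_ ?_
    · left
      rw [ex 0 hK0]
      simp only [hg, hc]
      rw [if_neg (by omega), if_neg (by omega)]
      rfl
    · intro x hx hx0
      rcases Nat.lt_or_ge x K with h' | h'
      · exact Or.inl (hint x (by omega) h' (by omega))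
      · right
        have : x = K := by omega
        rw [this, exK]
        split_ifs with hlt
        · exact hww _ hlt (by omega)
        · exact hww 0 (by omega) rfl

/-- a cycle contains a path -/
theorem lp_cycle_path {V : Type*} [DecidableEq V] (K m : ℕ) (hK : 0 < K) (hm : 1 ≤ m)
    (col : Finset V → Bool) (b : Bool) (h : HasLooseCycle (K + 1) m col b) :
    HasLoosePath (K + 1) (m - 1) col b := by
  obtain ⟨f, hf, he⟩ := h
  obtain ⟨m, rfl⟩ : ∃ m', m = m' + 1 := ⟨m - 1, by omega⟩
  simp only [Nat.add_sub_cancel] at hf he ⊢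
  have h1 : (m + 1) * K = m * K + K := by ring
  refine ⟨f, hf.mono ?_, ?_⟩
  · intro x hx
    simp only [Set.mem_Iio, Nat.add_sub_cancel] at hx ⊢
    omega
  · intro i hi
    rw [← he i (by omega)]
    congr 1
    apply Finset.image_congr
    intro j hj
    simp only [Finset.coe_range, Set.mem_Iio] at hj
    have : (i + 1) * K ≤ m * K := Nat.mul_le_mul_right K hi
    rw [Nat.add_mul] at this
    simp only [Nat.add_sub_cancel]
    rw [Nat.mod_eq_of_lt (by omega)]

/-- pulling back a coloring -/
theorem lp_lift {V W : Type*} [DecidableEq V] [DecidableEq W] (ι : V → W)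
    (hι : Function.Injective ι) (k n : ℕ) (col : Finset W → Bool) (b : Bool)
    (h : HasLooseCycle k n (fun S => col (S.image ι)) b) : HasLooseCycle k n col b := by
  obtain ⟨f, hf, he⟩ := h
  refine ⟨fun p => ι (f p), fun p hp q hq hpq => hf hp hq (hι hpq), ?_⟩
  intro i hi
  have := he i hi
  simp only [Finset.image_image] at this
  exact this

/-- extremal coloring -/
def lpCol (N M : ℕ) : Finset (Fin N) → Bool := fun S => decide (∀ x ∈ S, x.val < M)

theorem lp_no_red (N K n : ℕ) (hK : 0 < K) (hn : 1 ≤ n) :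
    ¬ HasLoosePath (K + 1) n (lpCol N (K * n)) true := by
  rintro ⟨f, hf, he⟩
  simp only [Nat.add_sub_cancel] at hf he
  have h1 : ∀ p < n * K + 1, (f p).val < K * n := by
    intro p hp
    obtain ⟨i, j, hi, hj, rfl⟩ : ∃ i j, i < n ∧ j < K + 1 ∧ p = i * K + j := by
      rcases Nat.lt_or_ge p (n * K) with h | h
      · refine ⟨p / K, p % K, Nat.div_lt_of_lt_mul (by rw [Nat.mul_comm]; exact h), ?_, ?_⟩
        · have := Nat.mod_lt p hK
          omega
        · rw [Nat.mul_comm]; exact (Nat.div_add_mod p K).symm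
      · obtain ⟨n, rfl⟩ : ∃ m', n = m' + 1 := ⟨n - 1, by omega⟩
        refine ⟨n, K, by omega, by omega, ?_⟩
        have : (n + 1) * K = n * K + K := by ring
        omega
    have := he i hi
    simp only [lpCol, decide_eq_true_eq] at this
    exact this _ (Finset.mem_image.2 ⟨j, Finset.mem_range.2 hj, rfl⟩)
  have h2 : (Finset.range (n * K + 1)).card ≤ (Finset.range (K * n)).card := by
    apply Finset.card_le_card_of_injOn (fun p => (f p).val)
    · intro p hp
      simp only [Finset.coe_range, Set.mem_Iio] at hp ⊢
      exact h1 p hp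
    · intro p hp q hq hpq
      simp only [Finset.coe_range] at hp hq
      exact hf hp hq (Fin.ext hpq)
  simp only [Finset.card_range] at h2
  rw [Nat.mul_comm] at h2
  omega

theorem lp_count (N M P L : ℕ) (f : ℕ → Fin N) (hf : Set.InjOn f (Set.Iio P))
    (pos a c : ℕ → ℕ) (h1 : ∀ i < L, pos i < P) (h2 : ∀ i < L, M ≤ (f (pos i)).val)
    (h3 : ∀ i < L, i = a (pos i) ∨ i = c (pos i)) : L ≤ 2 * (N - M) := by
  have key := Finset.card_le_mul_card_image_of_maps_to (s := Finset.range L)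
    (t := Finset.Ico M N) (f := fun i => (f (pos i)).val)
    (fun i hi => by
      have := h2 i (Finset.mem_range.1 hi)
      simp [this]) 2 ?_
  · simpa using key
  · intro y _
    rcases Finset.eq_empty_or_nonempty
      ((Finset.range L).filter fun i => (f (pos i)).val = y) with h | ⟨i0, hi0⟩
    · rw [h]; simp
    · simp only [Finset.mem_filter, Finset.mem_range] at hi0
      refine (Finset.card_le_card (t := {a (pos i0), c (pos i0)}) ?_).trans Finset.card_le_two
      intro i hi
      simp only [Finset.mem_filter, Finset.mem_range] at hi
      have : pos i = pos i0 :=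
        hf (h1 i hi.1) (h1 i0 hi0.1) (Fin.ext (hi.2.trans hi0.2.symm))
      rw [← this]
      simpa using h3 i hi.1

theorem lp_no_blue_path (N M K L : ℕ) (hK : 0 < K)
    (h : HasLoosePath (K + 1) L (lpCol N M) false) : L ≤ 2 * (N - M) := by
  obtain ⟨f, hf, he⟩ := h
  simp only [Nat.add_sub_cancel] at hf he
  have : ∀ i, ∃ j, j ≤ K ∧ (i < L → M ≤ (f (i * K + j)).val) := by
    intro i
    by_cases hi : i < L
    · have := he i hi
      simp only [lpCol, decide_eq_false_iff_not, not_forall, not_lt] at this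
      obtain ⟨x, hx, hMx⟩ := this
      obtain ⟨j, hj, rfl⟩ := Finset.mem_image.1 hx
      exact ⟨j, by simp at hj; omega, fun _ => hMx⟩
    · exact ⟨0, by omega, fun h => absurd h hi⟩
  choose j hj hjM using this
  refine lp_count N M _ L f hf (fun i => i * K + j i) (fun p => p / K) (fun p => p / K - 1)
    ?_ (fun i hi => hjM i hi) ?_
  · intro i hi
    have : (i + 1) * K ≤ L * K := Nat.mul_le_mul_right K hi
    rw [Nat.add_mul] at this
    have := hj i
    omega
  · intro i hi
    rcases Nat.lt_or_ge (j i) K with h | h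
    · left; rw [(lp_decomp hK i _ h).1]
    · right
      have h1 : j i = K := le_antisymm (hj i) h
      have h2 : i * K + K = (i + 1) * K := by ring
      rw [h1, h2, Nat.mul_div_cancel _ hK]
      omega

theorem lp_no_blue_cycle (N M K m : ℕ) (hK : 0 < K)
    (h : HasLooseCycle (K + 1) m (lpCol N M) false) : m ≤ 2 * (N - M) := by
  rcases Nat.eq_zero_or_pos m with h0 | h0
  · omega
  obtain ⟨f, hf, he⟩ := h
  simp only [Nat.add_sub_cancel] at hf he
  have : ∀ i, ∃ j, j ≤ K ∧ (i < m → M ≤ (f ((i * K + j) % (m * K))).val) := by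
    intro i
    by_cases hi : i < m
    · have := he i hi
      simp only [lpCol, decide_eq_false_iff_not, not_forall, not_lt] at this
      obtain ⟨x, hx, hMx⟩ := this
      obtain ⟨j, hj, rfl⟩ := Finset.mem_image.1 hx
      exact ⟨j, by simp at hj; omega, fun _ => hMx⟩
    · exact ⟨0, by omega, fun h => absurd h hi⟩
  choose j hj hjM using this
  refine lp_count N M _ m f hf (fun i => (i * K + j i) % (m * K)) (fun p => p / K)
    (fun p => if p / K = 0 then m - 1 else p / K - 1)
    ?_ (fun i hi => hjM i hi) ?_
  · intro i hi
    exact Nat.mod_lt _ (Nat.mul_pos h0 hK)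
  · intro i hi
    rcases Nat.lt_or_ge (j i) K with h | h
    · left; rw [Nat.mod_eq_of_lt (lp_lt hi h), (lp_decomp hK i _ h).1]
    · right
      have h1 : j i = K := le_antisymm (hj i) h
      have h2 : i * K + K = (i + 1) * K := by ring
      rw [h1, h2]
      rcases Nat.lt_or_ge (i + 1) m with h3 | h3
      · rw [Nat.mod_eq_of_lt (Nat.mul_lt_mul_of_pos_right h3 hK), Nat.mul_div_cancel _ hK]
        simp
      · have : i + 1 = m := by omega
        rw [this, Nat.mod_self]
        simp
        omega

theorem lp_sInf {S : Set ℕ} {a : ℕ} (h1 : a ∈ S) (h2 : ∀ N ∈ S, a ≤ N) : sInf S = a :=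
  le_antisymm (Nat.sInf_le h1) (h2 _ (Nat.sInf_mem ⟨a, h1⟩))

/-- If k ≥ 3, n ≥ m ≥ 2 and R(Cᵏₙ, Cᵏₘ) = (k-1)n + ⌊(m-1)/2⌋, then
R(Pᵏₙ, Cᵏₘ) = (k-1)n + ⌊(m+1)/2⌋ and R(Pᵏₙ, Pᵏ_{m-1}) = (k-1)n + ⌊m/2⌋;
moreover if n = m then R(Pᵏₙ, Pᵏₘ) = (k-1)n + ⌊(m+1)/2⌋. -/
theorem ramsey_paths_from_cycles (k n m : ℕ) (hk : 3 ≤ k) (hm : 2 ≤ m) (hnm : m ≤ n)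
    (h : RamseyCC k n m = (k - 1) * n + (m - 1) / 2) :
    RamseyPC k n m = (k - 1) * n + (m + 1) / 2 ∧
    RamseyPP k n (m - 1) = (k - 1) * n + m / 2 ∧
    (n = m → RamseyPP k n m = (k - 1) * n + (m + 1) / 2) := by
  obtain ⟨K, rfl⟩ : ∃ K, k = K + 1 := ⟨k - 1, by omega⟩
  simp only [Nat.add_sub_cancel] at h ⊢
  have hK : 0 < K := by omega
  have hpos : 0 < K * n := Nat.mul_pos hK (by omega)
  have hbase : ∀ N, K * n + (m - 1) / 2 ≤ N → ∀ col : Finset (Fin N) → Bool,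
      HasLooseCycle (K + 1) n col true ∨ HasLooseCycle (K + 1) m col false := by
    intro N hN col
    have hne : (0 : ℕ) < RamseyCC (K + 1) n m := by omega
    have hmem := Nat.sInf_mem (Nat.nonempty_of_pos_sInf hne)
    change RamseyCC (K + 1) n m ∈ _ at hmem
    rw [h] at hmem
    rcases hmem.2 (fun S => col (S.image (Fin.castLE hN))) with h1 | h1
    · exact Or.inl (lp_lift _ (Fin.castLE_injective hN) _ _ _ _ h1)
    · exact Or.inr (lp_lift _ (Fin.castLE_injective hN) _ _ _ _ h1)
  have hcomm : n * K = K * n := Nat.mul_comm _ _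
  refine ⟨lp_sInf ⟨by omega, ?_⟩ ?_, lp_sInf ⟨by omega, ?_⟩ ?_, fun hnm' => lp_sInf ⟨by omega, ?_⟩ ?_⟩
  · intro col
    rcases hbase _ (by omega) col with h1 | h1
    · exact lp_main_cycle K n m (by omega) hm hnm col true (by simp; omega) h1
    · exact Or.inr h1
  · rintro N ⟨_, hN⟩
    rcases hN (lpCol N (K * n)) with h1 | h1
    · exact absurd h1 (lp_no_red N K n hK (by omega))
    · have := lp_no_blue_cycle _ _ _ _ hK h1
      omega
  · intro col
    rcases hbase _ (by omega) col with h1 | h1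
    · exact lp_main_path K n (m - 1) (by omega) (by omega) (by omega) col true
        (by simp; omega) h1
    · exact Or.inr (lp_cycle_path K m hK (by omega) col false h1)
  · rintro N ⟨_, hN⟩
    rcases hN (lpCol N (K * n)) with h1 | h1
    · exact absurd h1 (lp_no_red N K n hK (by omega))
    · have := lp_no_blue_path _ _ _ _ hK h1
      omega
  · subst hnm'
    intro col
    rcases hbase _ (by omega) col with h1 | h1
    · exact lp_main_path K n n (by omega) (by omega) (by omega) col true
        (by simp; omega) h1
    · exact (lp_main_path K n n (by omega) (by omega) (by omega) col false
        (by simp; omega) h1).symm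
  · rintro N ⟨_, hN⟩
    rcases hN (lpCol N (K * n)) with h1 | h1
    · exact absurd h1 (lp_no_red N K n hK (by omega))
    · have := lp_no_blue_path _ _ _ _ hK h1
      omega
end

section
/- For every integer k ≥ 3, R(P^k_3, P^k_3) = R(C^k_3, P^k_3) = R(C^k_3, C^k_3) + 1 = 3k − 1. -/
namespace RT

variable {V : Type*} [DecidableEq V]

def AbsCycle (m : ℕ) (col : Finset V → Bool) (β : Bool) : Prop :=
  ∃ (a b c : V) (P Q R : Finset V), P.card = m ∧ Q.card = m ∧ R.card = m ∧
    (a ≠ b ∧ a ≠ c ∧ b ≠ c) ∧ (a ∉ P ∧ a ∉ Q ∧ a ∉ R) ∧ (b ∉ P ∧ b ∉ Q ∧ b ∉ R) ∧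
    (c ∉ P ∧ c ∉ Q ∧ c ∉ R) ∧
    ((∀ x ∈ P, x ∉ Q) ∧ (∀ x ∈ P, x ∉ R) ∧ (∀ x ∈ Q, x ∉ R)) ∧
    col (insert a (insert b P)) = β ∧ col (insert b (insert c Q)) = β ∧
    col (insert c (insert a R)) = β

def AbsPath (m : ℕ) (col : Finset V → Bool) (β : Bool) : Prop :=
  ∃ (b c : V) (P Q R : Finset V), P.card = m + 1 ∧ Q.card = m ∧ R.card = m + 1 ∧
    b ≠ c ∧ (b ∉ P ∧ b ∉ Q ∧ b ∉ R) ∧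
    (c ∉ P ∧ c ∉ Q ∧ c ∉ R) ∧
    ((∀ x ∈ P, x ∉ Q) ∧ (∀ x ∈ P, x ∉ R) ∧ (∀ x ∈ Q, x ∉ R)) ∧
    col (insert b P) = β ∧ col (insert b (insert c Q)) = β ∧
    col (insert c R) = β

lemma img (l l1 l2 l3 : List V) (d : V) (p n : ℕ) (hl : l = l1 ++ (l2 ++ l3))
    (h1 : l1.length = p) (h2 : l2.length = n) :
    ((Finset.range n).image fun j => l.getD (p + j) d) = l2.toFinset := by
  subst hl h1 h2
  ext v
  simp only [Finset.mem_image, Finset.mem_range, List.mem_toFinset]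
  constructor
  · rintro ⟨j, hj, rfl⟩
    rw [List.getD_append_right _ _ _ _ (by omega), Nat.add_sub_cancel_left,
      List.getD_append _ _ _ _ hj, List.getD_eq_getElem _ _ hj]
    exact List.getElem_mem hj
  · intro hv
    obtain ⟨j, hj, rfl⟩ := List.getElem_of_mem hv
    refine ⟨j, hj, ?_⟩
    rw [List.getD_append_right _ _ _ _ (by omega), Nat.add_sub_cancel_left,
      List.getD_append _ _ _ _ hj, List.getD_eq_getElem _ _ hj]

lemma inj (l : List V) (d : V) (hl : l.Nodup) (n : ℕ) (hn : n = l.length) :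
    Set.InjOn (fun i => l.getD i d) (Set.Iio n) := by
  subst hn
  intro i hi j hj h
  simp only [Set.mem_Iio] at hi hj
  simp only [List.getD_eq_getElem _ _ hi, List.getD_eq_getElem _ _ hj] at h
  exact (hl.getElem_inj_iff).1 h

lemma AbsPath.has {m : ℕ} {col : Finset V → Bool} {β : Bool} (h : AbsPath m col β) :
    HasLoosePath (m + 2) 3 col β := by
  obtain ⟨b, c, P, Q, R, hP, hQ, hR, hbc, hb, hc, hd, h1, h2, h3⟩ := h
  have lP : P.toList.length = m + 1 := by simp [hP]
  have lQ : Q.toList.length = m := by simp [hQ]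
  have lR : R.toList.length = m + 1 := by simp [hR]
  set l : List V := P.toList ++ ([b] ++ (Q.toList ++ ([c] ++ R.toList))) with hl
  have e1 := img l [] (P.toList ++ [b]) (Q.toList ++ ([c] ++ R.toList)) b (0 * (m + 1)) (m + 2)
    (by simp [hl]) (by simp) (by simp [hP])
  have e2 := img l (P.toList) ([b] ++ Q.toList ++ [c]) (R.toList) b (1 * (m + 1)) (m + 2)
    (by simp [hl]) (by simp [hP]) (by simp [hQ])
  have e3 := img l (P.toList ++ [b] ++ Q.toList) ([c] ++ R.toList) [] b (2 * (m + 1)) (m + 2)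
    (by simp [hl]) (by simp [hP, hQ]; omega) (by simp [hR])
  refine ⟨fun i => l.getD i b, inj l b ?_ _ ?_, ?_⟩
  · simp only [hl, List.nodup_append, List.mem_append, Finset.mem_toList, Finset.nodup_toList]
    simp
    grind
  · simp [hl, hP, hQ, hR]; omega
  · intro i hi
    have : m + 2 - 1 = m + 1 := rfl
    rw [this]
    interval_cases i
    · rw [e1, ← h1]; congr 1; ext; simp
    · rw [e2, ← h2]; congr 1; ext; simp
    · rw [e3, ← h3]; congr 1; ext; simp

lemma AbsCycle.has {m : ℕ} {col : Finset V → Bool} {β : Bool} (h : AbsCycle m col β) :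
    HasLooseCycle (m + 2) 3 col β := by
  obtain ⟨a, b, c, P, Q, R, hP, hQ, hR, hbc, ha, hb, hc, hd, h1, h2, h3⟩ := h
  set l : List V := [a] ++ (P.toList ++ ([b] ++ (Q.toList ++ ([c] ++ R.toList)))) with hl
  have hlen : l.length = 3 * (m + 1) := by simp [hl, hP, hQ, hR]; omega
  have e1 := img (l ++ [a]) [] ([a] ++ P.toList ++ [b]) (Q.toList ++ ([c] ++ R.toList) ++ [a]) b
    (0 * (m + 1)) (m + 2) (by simp [hl]) (by simp) (by simp [hP])
  have e2 := img (l ++ [a]) ([a] ++ P.toList) ([b] ++ Q.toList ++ [c]) (R.toList ++ [a]) b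
    (1 * (m + 1)) (m + 2)
    (by simp [hl]) (by simp [hP]) (by simp [hQ])
  have e3 := img (l ++ [a]) ([a] ++ P.toList ++ [b] ++ Q.toList) ([c] ++ R.toList ++ [a]) [] b
    (2 * (m + 1)) (m + 2)
    (by simp [hl]) (by simp [hP, hQ]; omega) (by simp [hR])
  have key : ∀ i < 3, ∀ j ∈ Finset.range (m + 2),
      l.getD ((i * (m + 1) + j) % (3 * (m + 1))) b = (l ++ [a]).getD (i * (m + 1) + j) b := by
    intro i hi j hj
    rw [Finset.mem_range] at hj
    have : i * (m + 1) + j ≤ 3 * (m + 1) := by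
      interval_cases i <;> omega
    rcases this.lt_or_eq with h | h
    · rw [Nat.mod_eq_of_lt h, List.getD_append l [a] _ _ (by omega)]
    · rw [h, Nat.mod_self, List.getD_append_right l [a] _ _ (by omega), hlen]
      simp [hl]
  refine ⟨fun i => l.getD i b, inj l b ?_ _ ?_, ?_⟩
  · simp only [hl, List.nodup_append, List.mem_append, Finset.mem_toList, Finset.nodup_toList]
    simp
    grind
  · exact hlen.symm
  · intro i hi
    have : m + 2 - 1 = m + 1 := rfl
    rw [this, Finset.image_congr (fun j hj => key i hi j (by simpa using hj))]
    interval_cases i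
    · rw [e1, ← h1]; congr 1; ext; simp
    · rw [e2, ← h2]; congr 1; ext; simp
    · rw [e3, ← h3]; congr 1; ext; simp

lemma johnson (g : Finset V → Bool) (U : Finset V) (n : ℕ)
    (h : ∀ D ⊆ U, D.card = n → ∀ x ∈ U, ∀ y ∈ U, x ∉ D → y ∉ D → g (insert x D) = g (insert y D)) :
    ∀ (r : ℕ) (A B : Finset V), A ⊆ U → B ⊆ U → A.card = n + 1 → B.card = n + 1 →
      (A \ B).card = r → g A = g B := by
  intro r
  induction r with
  | zero =>
    intro A B _ _ hA hB h0
    rw [Finset.card_eq_zero, Finset.sdiff_eq_empty_iff_subset] at h0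
    rw [Finset.eq_of_subset_of_card_le h0 (by omega)]
  | succ r ih =>
    intro A B hAU hBU hA hB hr
    have hr2 : (B \ A).card = r + 1 := by
      rw [← hr]; exact Finset.card_sdiff_comm (by omega)
    obtain ⟨a, ha⟩ := Finset.card_pos.1 (by omega : 0 < (A \ B).card)
    obtain ⟨b, hb⟩ := Finset.card_pos.1 (by omega : 0 < (B \ A).card)
    rw [Finset.mem_sdiff] at ha hb
    have hAe : (A.erase a).card = n := by rw [Finset.card_erase_of_mem ha.1]; omega
    have hbA : b ∉ A.erase a := fun h => hb.2 (Finset.mem_of_mem_erase h)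
    have s1 : g A = g (insert b (A.erase a)) := by
      have := h (A.erase a) ((Finset.erase_subset _ _).trans hAU) hAe a (hAU ha.1) b (hBU hb.1)
        (by simp) hbA
      rwa [Finset.insert_erase ha.1] at this
    rw [s1]
    apply ih
    · intro v hv
      rw [Finset.mem_insert] at hv
      rcases hv with rfl | hv
      · exact hBU hb.1
      · exact hAU (Finset.mem_of_mem_erase hv)
    · exact hBU
    · rw [Finset.card_insert_of_notMem hbA, hAe]
    · exact hB
    · have : insert b (A.erase a) \ B = (A \ B).erase a := by
        ext v; simp; grind
      rw [this, Finset.card_erase_of_mem (by simp [ha]), hr]; rfl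

lemma step1 {m : ℕ} {col : Finset V → Bool} (hno : ∀ β, ¬ AbsCycle m col β)
    {S W D : Finset V} {x y s t w : V} (hS : S.card = m + 1) (hxS : x ∉ S) (hyS : y ∉ S)
    (hcol : col (insert x S) ≠ col (insert y S)) (hW : W.card = 2 * m + 1)
    (hWS : ∀ v ∈ W, v ∉ S) (hxW : x ∉ W) (hyW : y ∉ W)
    (hs : s ∈ S) (ht : t ∈ S) (hst : s ≠ t) (hD : D ⊆ W) (hDc : D.card = m) (hw : w ∈ W)
    (hwD : w ∉ D) : col (insert s (insert w D)) ≠ col (insert t (W \ D)) := by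
  intro heq
  have main : ∀ z, z ∉ S → z ∉ W → col (insert z S) ≠ col (insert s (insert w D)) := by
    intro z hzS hzW hz
    apply hno (col (insert s (insert w D)))
    refine ⟨s, t, w, insert z ((S.erase s).erase t), (W \ D).erase w, D, ?_, ?_, hDc, ?_, ?_, ?_,
      ?_, ?_, ?_, ?_, ?_⟩
    · have h1 : t ∈ S.erase s := by simp [ht, hst.symm]
      have h2 : (S.erase s).card = m := by rw [Finset.card_erase_of_mem hs]; omega
      have := Finset.card_pos.2 ⟨t, h1⟩
      rw [Finset.card_insert_of_notMem (by simp [hzS]), Finset.card_erase_of_mem h1]; omega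
    · rw [Finset.card_erase_of_mem (by simp [hw, hwD]), Finset.card_sdiff_of_subset hD]; omega
    · grind
    · grind
    · grind
    · grind
    · grind
    · rw [← hz]; congr 1; grind
    · rw [heq]; congr 1; grind
    · congr 1; grind
  have hx := main x hxS hxW
  have hy := main y hyS hyW
  revert hcol hx hy
  cases col (insert x S) <;> cases col (insert y S) <;> cases col (insert s (insert w D)) <;> simp

lemma step4 {m : ℕ} {col : Finset V → Bool} (hno : ∀ β, ¬ AbsCycle m col β)
    {S W A : Finset V} {x y s t : V} (hS : S.card = m + 1) (hxS : x ∉ S) (hyS : y ∉ S)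
    (hcol : col (insert x S) ≠ col (insert y S)) (hW : W.card = 2 * m + 1)
    (hWS : ∀ v ∈ W, v ∉ S) (hxW : x ∉ W) (hyW : y ∉ W)
    (hs : s ∈ S) (ht : t ∈ S) (hst : s ≠ t) (hA : A ⊆ W) (hAc : A.card = m + 1) :
    col (insert s A) ≠ col (insert t A) := by
  have hc : (W \ A).card = m := by rw [Finset.card_sdiff_of_subset hA]; omega
  obtain ⟨w, hw⟩ := Finset.card_pos.1 (by omega : 0 < A.card)
  have hwW : w ∉ W \ A := by simp [hw]
  have h1 := step1 hno hS hxS hyS hcol hW hWS hxW hyW hs ht hst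
    (Finset.sdiff_subset : W \ A ⊆ W) hc (hA hw) hwW
  rw [Finset.sdiff_sdiff_eq_self hA] at h1
  rwa [johnson (fun B => col (insert s B)) W m ?_ _ A (insert w (W \ A)) hA ?_ hAc ?_ rfl]
  · intro D hD hDc p hp q hq hpD hqD
    have h2 := step1 hno hS hxS hyS hcol hW hWS hxW hyW hs ht hst hD hDc hp hpD
    have h3 := step1 hno hS hxS hyS hcol hW hWS hxW hyW hs ht hst hD hDc hq hqD

    revert h2 h3
    cases col (insert s (insert p D)) <;> cases col (insert s (insert q D)) <;>
      cases col (insert t (W \ D)) <;> simp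
  · intro v hv
    rw [Finset.mem_insert] at hv
    rcases hv with rfl | hv
    · exact hA hw
    · exact (Finset.mem_sdiff.1 hv).1
  · rw [Finset.card_insert_of_notMem hwW, hc]

lemma bool3 {a b c : Bool} (h1 : a ≠ b) (h2 : a ≠ c) (h3 : b ≠ c) : False := by
  revert h1 h2 h3; cases a <;> cases b <;> cases c <;> simp

lemma exists_sub [Fintype V] (T : Finset V) (n : ℕ) (h : T.card + n ≤ Fintype.card V) :
    ∃ W : Finset V, W.card = n ∧ ∀ v ∈ W, v ∉ T := by
  obtain ⟨W, hW, hc⟩ := Finset.exists_subset_card_eq (s := Tᶜ) (n := n)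
    (by rw [Finset.card_compl]; omega)
  exact ⟨W, hc, fun v hv => by simpa using hW hv⟩

lemma part1 [Fintype V] {m : ℕ} (hm : 1 ≤ m) (hV : 3 * m + 4 ≤ Fintype.card V)
    (col : Finset V → Bool) : ∃ β, AbsCycle m col β := by
  by_contra! hno
  by_cases hconst : ∀ D : Finset V, D.card = m + 1 → ∀ x y, x ∉ D → y ∉ D →
      col (insert x D) = col (insert y D)
  · have hall : ∀ A B : Finset V, A.card = m + 2 → B.card = m + 2 → col A = col B :=
      fun A B hA hB => johnson col Finset.univ (m + 1)
        (fun D _ hD x _ y _ hx hy => hconst D hD x y hx hy) _ A B (by simp) (by simp) hA hB rfl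
    obtain ⟨P, hP, -⟩ := exists_sub (∅ : Finset V) m (by simp; omega)
    obtain ⟨Q, hQ, hQP⟩ := exists_sub P m (by omega)
    obtain ⟨R, hR, hRP⟩ := exists_sub (P ∪ Q) m
      (by have := Finset.card_union_le P Q; omega)
    obtain ⟨T, hT, hTP⟩ := exists_sub (P ∪ Q ∪ R) 3
      (by have := Finset.card_union_le P Q; have := Finset.card_union_le (P ∪ Q) R; omega)
    obtain ⟨a, b, c, hab, hac, hbc, rfl⟩ := Finset.card_eq_three.1 hT
    have ha : a ∉ P ∪ Q ∪ R := hTP a (by simp)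
    have hb : b ∉ P ∪ Q ∪ R := hTP b (by simp)
    have hc : c ∉ P ∪ Q ∪ R := hTP c (by simp)
    clear hTP
    apply hno (col (insert a (insert b P)))
    refine ⟨a, b, c, P, Q, R, hP, hQ, hR, ⟨hab, hac, hbc⟩, by grind, by grind, by grind,
      by grind, rfl, ?_, ?_⟩ <;> apply hall <;> grind
  · push Not at hconst
    obtain ⟨S, hS, x, y, hxS, hyS, hcol⟩ := hconst
    have hxy : x ≠ y := by rintro rfl; exact hcol rfl
    obtain ⟨W, hW, hWT⟩ := exists_sub (insert x (insert y S)) (2 * m + 1) (by grind)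
    have hWS : ∀ v ∈ W, v ∉ S := by grind
    have hxW : x ∉ W := by grind
    have hyW : y ∉ W := by grind
    by_cases hm2 : 2 ≤ m
    · obtain ⟨s, hs, t, ht, u, hu, hst, hsu, htu⟩ := Finset.two_lt_card.1 (by omega : 2 < S.card)
      obtain ⟨A, hA, hAc⟩ := Finset.exists_subset_card_eq (s := W) (n := m + 1) (by omega)
      exact bool3 (step4 hno hS hxS hyS hcol hW hWS hxW hyW hs ht hst hA hAc)
        (step4 hno hS hxS hyS hcol hW hWS hxW hyW hs hu hsu hA hAc)
        (step4 hno hS hxS hyS hcol hW hWS hxW hyW ht hu htu hA hAc)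
    · obtain rfl : m = 1 := by omega
      obtain ⟨s, t, hst, rfl⟩ := Finset.card_eq_two.1 hS
      have hs : s ∈ ({s, t} : Finset V) := by simp
      have ht : t ∈ ({s, t} : Finset V) := by simp
      have key : ∀ p q r : V, p ≠ q → p ≠ r → q ≠ r → p ∈ W → q ∈ W → r ∈ W →
          col (insert p {x, y}) ≠ col (insert q {x, y}) := by
        intro p q r hpq hpr hqr hp hq hr
        have hd := step4 hno hS hxS hyS hcol hW hWS hxW hyW hs ht hst (A := {p, q})
          (by grind) (by grind)
        exact step4 hno (S := {p, q}) (W := {x, y, r}) (x := s) (y := t) (by grind) (by grind)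
          (by grind) hd (by grind) (by grind) (by grind) (by grind) (by simp) (by simp) hpq
          (by grind) (by grind)
      obtain ⟨p, q, r, hpq, hpr, hqr, rfl⟩ := Finset.card_eq_three.1 hW
      exact bool3 (key p q r hpq hpr hqr (by simp) (by simp) (by simp))
        (key p r q hpr hpq hqr.symm (by simp) (by simp) (by simp))
        (key q r p hqr hpq.symm hpr.symm (by simp) (by simp) (by simp))

lemma part2 [Fintype V] {m : ℕ} (hm : 1 ≤ m) (hV : 3 * m + 5 ≤ Fintype.card V)
    {col : Finset V → Bool} {β : Bool} (hc : AbsCycle m col β) (hp : ¬ AbsPath m col β) :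
    AbsCycle m col (!β) ∧ AbsPath m col (!β) := by
  obtain ⟨a, b, c, A, B, C, hA, hB, hC, hne, ha, hb, hc, hd, h1, h2, h3⟩ := hc
  obtain ⟨T, hT, hTT⟩ := exists_sub (insert a (insert b (insert c (A ∪ B ∪ C)))) 2 (by grind)
  obtain ⟨x, y, hxy, rfl⟩ := Finset.card_eq_two.1 hT
  have hx := hTT x (by simp)
  have hy := hTT y (by simp)
  clear hTT hT
  simp only [Finset.mem_insert, Finset.mem_union, not_or] at hx hy
  obtain ⟨r, hr⟩ := Finset.card_pos.1 (by omega : 0 < A.card)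
  have neg : ∀ e, (col e = β → AbsPath m col β) → col e = !β := by
    intro e he
    have : col e ≠ β := fun h => hp (he h)
    revert this; cases col e <;> cases β <;> simp
  have E1 : col (insert a (insert x C)) = !β := by
    apply neg; intro h
    refine ⟨b, a, insert c B, A, insert x C, ?_, hA, ?_, ?_, ?_, ?_, ?_, ?_, ?_, h⟩
    · grind
    · grind
    · grind
    · grind
    · grind
    · grind
    · rw [← h2]
    · rw [← h1]; congr 1; grind
  have E2 : col (insert a (insert y A)) = !β := by
    apply neg; intro h
    refine ⟨c, a, insert b B, C, insert y A, ?_, hC, ?_, ?_, ?_, ?_, ?_, ?_, h3, h⟩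
    · grind
    · grind
    · grind
    · grind
    · grind
    · grind
    · rw [← h2]; congr 1; grind
  have E3 : col (insert b (insert x B)) = !β := by
    apply neg; intro h
    refine ⟨a, b, insert c C, A, insert x B, ?_, hA, ?_, ?_, ?_, ?_, ?_, ?_, h1, h⟩
    · grind
    · grind
    · grind
    · grind
    · grind
    · grind
    · rw [← h3]; congr 1; grind
  have E4 : col (insert r (insert x B)) = !β := by
    apply neg; intro h
    refine ⟨a, r, insert c C, insert b (A.erase r), insert x B, ?_, ?_, ?_, ?_, ?_, ?_, ?_, ?_, ?_, h⟩
    · grind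
    · grind
    · grind
    · grind
    · grind
    · grind
    · grind
    · rw [← h3]; congr 1; grind
    · rw [← h1]; congr 1; grind
  constructor
  · refine ⟨a, x, r, C, B, insert y (A.erase r), hC, hB, ?_, ?_, ?_, ?_, ?_, ?_, E1, ?_, ?_⟩
    · grind
    · grind
    · grind
    · grind
    · grind
    · grind
    · rw [← E4]; congr 1; grind
    · rw [← E2]; congr 1; grind
  · refine ⟨a, x, insert y A, C, insert b B, ?_, hC, ?_, ?_, ?_, ?_, ?_, E2, E1, ?_⟩
    · grind
    · grind
    · grind
    · grind
    · grind
    · grind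
    · rw [← E3]; congr 1; grind

/-! Lower bounds -/

lemma avoid {N : ℕ} (hN : 0 < N) (f : ℕ → Fin N) (n : ℕ) (hf : Set.InjOn f (Set.Iio n))
    (h : ∀ i < n, f i ≠ ⟨0, hN⟩) : n + 1 ≤ N := by
  have h1 : ((Finset.range n).image f).card = n := by
    rw [Finset.card_image_of_injOn (by simpa using hf), Finset.card_range]
  have h2 : (⟨0, hN⟩ : Fin N) ∉ (Finset.range n).image f := by
    simp only [Finset.mem_image, Finset.mem_range, not_exists, not_and]
    exact h
  have h3 := Finset.card_le_univ (insert (⟨0, hN⟩ : Fin N) ((Finset.range n).image f))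
  rw [Finset.card_insert_of_notMem h2, h1, Fintype.card_fin] at h3
  exact h3

lemma path_star {m : ℕ} {col : Finset V → Bool} {β : Bool} (z : V)
    (h : ∀ e, col e = β → z ∈ e) : ¬ HasLoosePath (m + 2) 3 col β := by
  rintro ⟨f, hf, he⟩
  have h0 := h _ (he 0 (by omega))
  have h2 := h _ (he 2 (by omega))
  simp only [Finset.mem_image, Finset.mem_range] at h0 h2
  obtain ⟨i, hi, hi2⟩ := h0
  obtain ⟨j, hj, hj2⟩ := h2
  have := hf (by simp; omega) (by simp; omega) (hi2.trans hj2.symm)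
  omega

lemma cycle_star {m : ℕ} {col : Finset V → Bool} {β : Bool} (z : V)
    (h : ∀ e, col e = β → z ∈ e) : ¬ HasLooseCycle (m + 2) 3 col β := by
  rintro ⟨f, hf, he⟩
  have h0 := h _ (he 0 (by omega))
  have h1 := h _ (he 1 (by omega))
  have h2 := h _ (he 2 (by omega))
  simp only [Finset.mem_image, Finset.mem_range] at h0 h1 h2
  obtain ⟨i, hi, hi2⟩ := h0
  obtain ⟨j, hj, hj2⟩ := h1
  obtain ⟨l, hl, hl2⟩ := h2
  have hpos : 0 < 3 * (m + 2 - 1) := by omega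
  have a1 := hf (Nat.mod_lt _ hpos) (Nat.mod_lt _ hpos) (hi2.trans hj2.symm)
  have a2 := hf (Nat.mod_lt _ hpos) (Nat.mod_lt _ hpos) (hi2.trans hl2.symm)
  have e : m + 2 - 1 = m + 1 := rfl
  rw [e] at a1 a2
  rw [Nat.mod_eq_of_lt (by omega), Nat.mod_eq_of_lt (by omega)] at a1
  rw [Nat.mod_eq_of_lt (by omega)] at a2
  by_cases hlt : l < m + 1
  · rw [Nat.mod_eq_of_lt (by omega)] at a2
    omega
  · have : 2 * (m + 1) + l = 3 * (m + 1) := by omega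
    rw [this, Nat.mod_self] at a2
    omega

lemma path_avoid {m N : ℕ} (hN : 0 < N) {col : Finset (Fin N) → Bool} {β : Bool}
    (h : ∀ e, col e = β → (⟨0, hN⟩ : Fin N) ∉ e) (hp : HasLoosePath (m + 2) 3 col β) :
    3 * m + 5 ≤ N := by
  obtain ⟨f, hf, he⟩ := hp
  have := avoid hN f _ hf ?_
  · omega
  intro i hi hi2
  have e : m + 2 - 1 = m + 1 := rfl
  have key : ∀ q < 3, ∀ j < m + 2, i = q * (m + 1) + j → False := by
    intro q hq j hj hij
    apply h _ (he q hq)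
    rw [Finset.mem_image]
    exact ⟨j, by simpa using hj, by rw [e, ← hij, hi2]⟩
  by_cases c1 : i < m + 2
  · exact key 0 (by omega) i c1 (by omega)
  by_cases c2 : i < 2 * m + 3
  · exact key 1 (by omega) (i - (m + 1)) (by omega) (by omega)
  · exact key 2 (by omega) (i - 2 * (m + 1)) (by omega) (by omega)

lemma cycle_avoid {m N : ℕ} (hN : 0 < N) {col : Finset (Fin N) → Bool} {β : Bool}
    (h : ∀ e, col e = β → (⟨0, hN⟩ : Fin N) ∉ e) (hp : HasLooseCycle (m + 2) 3 col β) :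
    3 * m + 4 ≤ N := by
  obtain ⟨f, hf, he⟩ := hp
  have := avoid hN f _ hf ?_
  · omega
  intro i hi hi2
  have e : m + 2 - 1 = m + 1 := rfl
  rw [e] at hi
  have key : ∀ q < 3, ∀ j < m + 2, i = q * (m + 1) + j → False := by
    intro q hq j hj hij
    apply h _ (he q hq)
    rw [Finset.mem_image]
    exact ⟨j, by simpa using hj, by rw [e, ← hij, Nat.mod_eq_of_lt hi, hi2]⟩
  by_cases c1 : i < m + 2
  · exact key 0 (by omega) i c1 (by omega)
  by_cases c2 : i < 2 * m + 3
  · exact key 1 (by omega) (i - (m + 1)) (by omega) (by omega)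
  · exact key 2 (by omega) (i - 2 * (m + 1)) (by omega) (by omega)

lemma sInf_eq {s : Set ℕ} {n : ℕ} (h1 : n ∈ s) (h2 : ∀ N ∈ s, n ≤ N) : sInf s = n :=
  le_antisymm (Nat.sInf_le h1) (h2 _ (Nat.sInf_mem ⟨n, h1⟩))

end RT

open RT in
/-- For every k ≥ 3, R(Pᵏ₃, Pᵏ₃) = R(Cᵏ₃, Pᵏ₃) = R(Cᵏ₃, Cᵏ₃) + 1 = 3k - 1. -/
theorem ramsey_triangle (k : ℕ) (hk : 3 ≤ k) :
    RamseyPP k 3 3 = 3 * k - 1 ∧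
    RamseyCP k 3 3 = 3 * k - 1 ∧
    RamseyCC k 3 3 + 1 = 3 * k - 1 := by
  obtain ⟨m, rfl⟩ : ∃ m, k = m + 2 := ⟨k - 2, by omega⟩
  have hm : 1 ≤ m := by omega
  have r1 : 3 * (m + 2) - 1 = 3 * m + 5 := by omega
  rw [r1]
  refine ⟨sInf_eq ⟨by omega, fun col => ?_⟩ ?_, sInf_eq ⟨by omega, fun col => ?_⟩ ?_, ?_⟩
  · obtain ⟨β, hβ⟩ := part1 hm (by simp) col
    have hP : ∃ γ, AbsPath m col γ := by
      by_cases h : AbsPath m col β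
      · exact ⟨_, h⟩
      · exact ⟨_, (part2 hm (by simp) hβ h).2⟩
    obtain ⟨γ, hγ⟩ := hP
    cases γ
    · exact Or.inr hγ.has
    · exact Or.inl hγ.has
  · rintro N ⟨hN, h⟩
    rcases h (fun e => decide ((⟨0, hN⟩ : Fin N) ∈ e)) with h | h
    · exact absurd h (path_star ⟨0, hN⟩ (by simp))
    · exact path_avoid hN (by simp) h
  · obtain ⟨β, hβ⟩ := part1 hm (by simp) col
    cases β
    · by_cases h : AbsPath m col false
      · exact Or.inr h.has
      · exact Or.inl (part2 hm (by simp) hβ h).1.has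
    · exact Or.inl hβ.has
  · rintro N ⟨hN, h⟩
    rcases h (fun e => decide ((⟨0, hN⟩ : Fin N) ∈ e)) with h | h
    · exact absurd h (cycle_star ⟨0, hN⟩ (by simp))
    · exact path_avoid hN (by simp) h
  · refine congrArg (· + 1) (?_ : RamseyCC (m + 2) 3 3 = 3 * m + 4)
    refine sInf_eq ⟨by omega, fun col => ?_⟩ ?_
    · obtain ⟨β, hβ⟩ := part1 hm (by simp) col
      cases β
      · exact Or.inr hβ.has
      · exact Or.inl hβ.has
    · rintro N ⟨hN, h⟩
      rcases h (fun e => decide ((⟨0, hN⟩ : Fin N) ∈ e)) with h | h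
      · exact absurd h (cycle_star ⟨0, hN⟩ (by simp))
      · exact cycle_avoid hN (by simp) h
end
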